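/- arXiv:1907.03347 — 2 statements merged into one kernel-verified Lean document; each statement's English description precedes it below -/
import Mathlib

section
/- The only positive integers expressible in more than one way as 2^x + 3^y with x, y nonnegative integers are 5, 11, 17, 35, and 259. -/
/-- Dividing `M√A + K√-c` by `S + T√(-Ac)`, after removing the common factor `g`. -/
theorem exists_quotient {A c M K S T N₁ N₂ N₃ g : ℤ} (hg : g ≠ 0) (hgA : IsCoprime g A)
    (h₁ : A * M ^ 2 + c * K ^ 2 = N₁) (h₂ : S ^ 2 + A * c * T ^ 2 = N₂)
    (hN : N₁ * N₂ = g ^ 2 * N₃) (hd : g ∣ K * S - A * M * T) :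
    ∃ M' K' : ℤ, A * M' ^ 2 + c * K' ^ 2 = N₃ ∧ g * K' = K * S - A * M * T ∧
      g * (S * M' - c * T * K') = M * N₂ ∧ g * (S * K' + A * T * M') = K * N₂ ∧
      g * (A * M * M' + c * K * K') = S * N₁ := by
  obtain ⟨K', hK'⟩ := hd
  have hsq : g ^ 2 ∣ (M * S + c * K * T) ^ 2 := by
    have : g ^ 2 ∣ A * (M * S + c * K * T) ^ 2 := by
      refine ⟨N₃ - c * K' ^ 2, ?_⟩
      rw [mul_sub, ← hN, ← h₁, ← h₂]
      linear_combination (-c) * (K * S - A * M * T + g * K') * hK'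
    exact (hgA.pow_left).dvd_of_dvd_mul_left this
  obtain ⟨M', hM'⟩ := (Int.pow_dvd_pow_iff two_ne_zero).1 hsq
  refine ⟨M', K', ?_, hK'.symm, ?_, ?_, ?_⟩
  · apply mul_left_cancel₀ (pow_ne_zero 2 hg)
    rw [← hN, ← h₁, ← h₂]
    linear_combination (-A * (M * S + c * K * T + g * M')) * hM'
      - c * (K * S - A * M * T + g * K') * hK'
  · rw [← h₂]; linear_combination (-S) * hM' + c * T * hK'
  · rw [← h₂]; linear_combination (-S) * hK' - A * T * hM'
  · rw [← h₁]; linear_combination (-A * M) * hM' - c * K * hK'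

theorem not_three_dvd_of_norm_eq {A c M K : ℤ} {n : ℕ} (hn : 0 < n) (hc : ¬ 3 ∣ c) (hK : ¬ 3 ∣ K)
    (h : A * M ^ 2 + c * K ^ 2 = 3 ^ n) : ¬ (3 : ℤ) ∣ M := by
  intro hM
  have h3 : (3 : ℤ) ∣ 3 ^ n := dvd_pow_self _ hn.ne'
  have : (3 : ℤ) ∣ c * K ^ 2 := by
    rw [← h] at h3
    exact (dvd_add_right (dvd_mul_of_dvd_right (dvd_pow hM two_ne_zero) _)).1 h3
  rcases Int.prime_three.dvd_or_dvd this with h | h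
  · exact hc h
  · exact hK (Int.prime_three.dvd_of_dvd_pow h)

theorem descent_three {A c : ℤ} (hA : 0 < A) (hA3 : ¬ 3 ∣ A) (hc : 1 < c) (hc3 : ¬ 3 ∣ c)
    {n₀ : ℕ} {m k : ℤ} (hn₀ : 0 < n₀) (hk : ¬ 3 ∣ k) (hγ : A * m ^ 2 + c * k ^ 2 = 3 ^ n₀)
    (hmin : ∀ (n : ℕ) (M K : ℤ), 0 < n → n < n₀ → ¬ 3 ∣ K → A * M ^ 2 + c * K ^ 2 ≠ 3 ^ n)
    (n : ℕ) : ∀ M K : ℤ, 0 < n → ¬ 3 ∣ K → A * M ^ 2 + c * K ^ 2 = 3 ^ n →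
      2 ∣ K ∨ (k ∣ K ∧ ∃ q, Odd q ∧ M = m * q) := by
  have hp := Int.prime_three
  have hm : ¬ (3 : ℤ) ∣ m := not_three_dvd_of_norm_eq hn₀ hc3 hk hγ
  have h3n₀ : (3 : ℤ) ∣ 3 ^ n₀ := dvd_pow_self _ hn₀.ne'
  have cop : ∀ j : ℕ, IsCoprime ((3 : ℤ) ^ j) A := fun j =>
    (hp.coprime_iff_not_dvd.2 hA3).pow_left
  set S := A * m ^ 2 - c * k ^ 2 with hS
  have hS3 : ¬ (3 : ℤ) ∣ S := by
    intro h
    have : (3 : ℤ) ∣ 2 * (c * k ^ 2) := by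
      have := dvd_sub h3n₀ h
      rwa [← hγ, hS, show A * m ^ 2 + c * k ^ 2 - (A * m ^ 2 - c * k ^ 2) = 2 * (c * k ^ 2) by ring]
        at this
    rcases hp.dvd_or_dvd this with h | h
    · omega
    rcases hp.dvd_or_dvd h with h | h
    · exact hc3 h
    · exact hk (hp.dvd_of_dvd_pow h)
  have hSodd : Odd S := by
    have h1 : Odd ((3 : ℤ) ^ n₀) := Odd.pow (by decide)
    have : S = 3 ^ n₀ - 2 * (c * k ^ 2) := by rw [← hγ, hS]; ring
    rw [this]
    exact h1.sub_even (even_two_mul _)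
  induction n using Nat.strong_induction_on with
  | _ n ih =>
  intro M K hn hK h
  have hM : ¬ (3 : ℤ) ∣ M := not_three_dvd_of_norm_eq hn hc3 hK h
  obtain ⟨T, hT, hTd⟩ : ∃ T : ℤ, (T = 2 * m * k ∨ T = -(2 * m * k)) ∧
      (3 : ℤ) ^ min n (2 * n₀) ∣ K * S - A * M * T := by
    set T₀ := 2 * m * k with hT₀
    have hprod : (3 : ℤ) ^ min n (2 * n₀) ∣ (K * S - A * M * T₀) * (K * S + A * M * T₀) := by
      have : (3 : ℤ) ^ min n (2 * n₀) ∣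
          c * ((K * S - A * M * T₀) * (K * S + A * M * T₀)) := by
        have e : c * ((K * S - A * M * T₀) * (K * S + A * M * T₀)) =
            3 ^ n * S ^ 2 - A * M ^ 2 * 3 ^ (2 * n₀) := by
          rw [mul_comm 2 n₀, pow_mul, ← h, ← hγ, hS, hT₀]; ring
        rw [e]
        exact dvd_sub (dvd_mul_of_dvd_left (pow_dvd_pow _ (min_le_left _ _)) _)
          (dvd_mul_of_dvd_right (pow_dvd_pow _ (min_le_right _ _)) _)
      exact hp.pow_dvd_of_dvd_mul_left _ hc3 this
    by_cases h1 : (3 : ℤ) ∣ K * S - A * M * T₀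
    · have h2 : ¬ (3 : ℤ) ∣ K * S + A * M * T₀ := by
        intro h2
        have : (3 : ℤ) ∣ 2 * (K * S) := by
          have := dvd_add h1 h2
          rwa [show K * S - A * M * T₀ + (K * S + A * M * T₀) = 2 * (K * S) by ring] at this
        rcases hp.dvd_or_dvd this with h | h
        · omega
        · exact (hp.dvd_or_dvd h).elim hK hS3
      exact ⟨T₀, .inl rfl, hp.pow_dvd_of_dvd_mul_right _ h2 hprod⟩
    · refine ⟨-T₀, .inr rfl, ?_⟩
      rw [mul_neg, sub_neg_eq_add]
      exact hp.pow_dvd_of_dvd_mul_left _ h1 hprod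
  have hT2 : 2 ∣ T := by
    rcases hT with rfl | rfl
    · exact ⟨m * k, by ring⟩
    · exact ⟨-(m * k), by ring⟩
  have hTm : ∃ t, T = m * k * (2 * t) := by
    rcases hT with rfl | rfl
    · exact ⟨1, by ring⟩
    · exact ⟨-1, by ring⟩
  have hnorm : S ^ 2 + A * c * T ^ 2 = 3 ^ (2 * n₀) := by
    have : T ^ 2 = (2 * m * k) ^ 2 := by rcases hT with rfl | rfl <;> ring
    rw [this, mul_comm 2 n₀, pow_mul, ← hγ, hS]; ring
  rcases lt_trichotomy n n₀ with hlt | rfl | hgt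
  · exact absurd h (hmin n M K hn hlt hK)
  · right
    -- the two representations of the minimal power agree up to signs
    have hprod : (3 : ℤ) ^ n ∣ (K * m - M * k) * (K * m + M * k) := by
      have : (3 : ℤ) ^ n ∣ c * ((K * m - M * k) * (K * m + M * k)) := by
        refine ⟨m ^ 2 - M ^ 2, ?_⟩
        linear_combination m ^ 2 * h - M ^ 2 * hγ
      exact hp.pow_dvd_of_dvd_mul_left _ hc3 this
    have key : ∀ κ : ℤ, A * m ^ 2 + c * κ ^ 2 = 3 ^ n → (3 : ℤ) ^ n ∣ K * m - M * κ →
        K * m = M * κ := by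
      rintro κ hκ ⟨t, ht⟩
      have e : (A * M * m + c * K * κ) ^ 2 + A * c * (K * m - M * κ) ^ 2 = (3 ^ n) ^ 2 := by
        calc _ = (A * M ^ 2 + c * K ^ 2) * (A * m ^ 2 + c * κ ^ 2) := by ring
          _ = _ := by rw [h, hκ]; ring
      have hpos : (0 : ℤ) < (3 ^ n) ^ 2 := by positivity
      have ht0 : t = 0 := by
        by_contra hne
        have h1 : 1 ≤ t ^ 2 := by
          have := sq_pos_of_ne_zero hne
          omega
        have h2 : 1 < A * c := by nlinarith
        have h3 : 1 < A * c * t ^ 2 := by nlinarith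
        rw [ht, mul_pow] at e
        nlinarith [sq_nonneg (A * M * m + c * K * κ)]
      rw [ht0, mul_zero, sub_eq_zero] at ht
      exact ht
    have fin : ∀ κ : ℤ, A * m ^ 2 + c * κ ^ 2 = 3 ^ n → K * m = M * κ → κ ^ 2 = k ^ 2 →
        k ∣ K ∧ ∃ q, Odd q ∧ M = m * q := by
      intro κ hκ e hκk
      have hsq : m ^ 2 = M ^ 2 := by
        have hpos : (3 : ℤ) ^ n ≠ 0 := by positivity
        apply mul_left_cancel₀ hpos
        linear_combination (-m ^ 2) * h + M ^ 2 * hκ + c * (K * m + M * κ) * e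
      have hKk : K ^ 2 = k ^ 2 := by
        have : c * K ^ 2 = c * k ^ 2 := by linear_combination h - hγ + A * hsq
        exact mul_left_cancel₀ (by omega) this
      constructor
      · rcases sq_eq_sq_iff_eq_or_eq_neg.1 hKk with h | h <;> simp [h]
      · rcases sq_eq_sq_iff_eq_or_eq_neg.1 hsq with h | h
        · exact ⟨1, by decide, by simp [h]⟩
        · exact ⟨-1, by decide, by simp [h]⟩
    by_cases h1 : (3 : ℤ) ∣ K * m - M * k
    · have h2 : ¬ (3 : ℤ) ∣ K * m + M * k := by
        intro h2
        have : (3 : ℤ) ∣ 2 * (K * m) := by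
          have := dvd_add h1 h2
          rwa [show K * m - M * k + (K * m + M * k) = 2 * (K * m) by ring] at this
        rcases hp.dvd_or_dvd this with h | h
        · omega
        · exact (hp.dvd_or_dvd h).elim hK hm
      exact fin k hγ (key k hγ (hp.pow_dvd_of_dvd_mul_right _ h2 hprod)) rfl
    · have h2 : (3 : ℤ) ^ n ∣ K * m - M * (-k) := by
        rw [mul_neg, sub_neg_eq_add]
        exact hp.pow_dvd_of_dvd_mul_left _ h1 hprod
      have hγ' : A * m ^ 2 + c * (-k) ^ 2 = 3 ^ n := by rw [neg_sq, hγ]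
      exact fin (-k) hγ' (key (-k) hγ' h2) (neg_sq k)
  rcases lt_or_ge n (2 * n₀) with hlt | hge
  · exfalso
    rw [min_eq_left hlt.le] at hTd
    obtain ⟨M', K', h', hK', -, -, hS'⟩ := exists_quotient (N₃ := 3 ^ (2 * n₀ - n))
      (by positivity) (cop n) h hnorm
      (by rw [← pow_add, ← pow_mul, ← pow_add]; congr 1; omega) hTd
    have hSe : A * M * M' + c * K * K' = S := by
      have : (3 : ℤ) ^ n ≠ 0 := by positivity
      apply mul_left_cancel₀ this
      rw [hS', mul_comm]
    refine hmin (2 * n₀ - n) M' K' (by omega) (by omega) ?_ h'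
    intro h3
    have h3n : (3 : ℤ) ∣ 3 ^ (2 * n₀ - n) := dvd_pow_self _ (by omega)
    have : (3 : ℤ) ∣ A * M' ^ 2 := by
      rw [← h'] at h3n
      exact (dvd_add_left (dvd_mul_of_dvd_right (dvd_pow h3 two_ne_zero) _)).1 h3n
    have hM3 : (3 : ℤ) ∣ M' :=
      (hp.dvd_or_dvd this).elim (fun h => absurd h hA3) hp.dvd_of_dvd_pow
    exact hS3 (hSe ▸ dvd_add (dvd_mul_of_dvd_right hM3 _) (dvd_mul_of_dvd_right h3 _))
  · rw [min_eq_right hge] at hTd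
    obtain ⟨M', K', h', -, hMe, hKe, -⟩ := exists_quotient (N₃ := 3 ^ (n - 2 * n₀))
      (by positivity) (cop (2 * n₀)) h hnorm
      (by rw [← pow_add, ← pow_mul, ← pow_add]; congr 1; omega) hTd
    have h0 : (3 : ℤ) ^ (2 * n₀) ≠ 0 := by positivity
    replace hMe : M = S * M' - c * T * K' := by
      apply mul_left_cancel₀ h0
      rw [hMe, mul_comm]
    replace hKe : K = S * K' + A * T * M' := by
      apply mul_left_cancel₀ h0
      rw [hKe, mul_comm]
    rcases hge.eq_or_lt with heq | hlt
    · left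
      rw [← heq, Nat.sub_self, pow_zero] at h'
      have hK0 : K' = 0 := by
        by_contra hne
        have := sq_pos_of_ne_zero hne
        nlinarith [mul_nonneg hA.le (sq_nonneg M')]
      rw [hKe, hK0, mul_zero, zero_add]
      exact dvd_mul_of_dvd_left (dvd_mul_of_dvd_right hT2 _) _
    · have hK3 : ¬ (3 : ℤ) ∣ K' := by
        intro h3
        have h3n : (3 : ℤ) ∣ 3 ^ (n - 2 * n₀) := dvd_pow_self _ (by omega)
        have : (3 : ℤ) ∣ A * M' ^ 2 := by
          rw [← h'] at h3n
          exact (dvd_add_left (dvd_mul_of_dvd_right (dvd_pow h3 two_ne_zero) _)).1 h3n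
        have hM3 : (3 : ℤ) ∣ M' :=
          (hp.dvd_or_dvd this).elim (fun h => absurd h hA3) hp.dvd_of_dvd_pow
        exact hK (hKe ▸ dvd_add (dvd_mul_of_dvd_right h3 _) (dvd_mul_of_dvd_right hM3 _))
      rcases ih (n - 2 * n₀) (by omega) M' K' (by omega) hK3 h' with h2 | ⟨⟨κ, rfl⟩, q, hq, rfl⟩
      · left
        rw [hKe]
        exact dvd_add (dvd_mul_of_dvd_right h2 _)
          (dvd_mul_of_dvd_left (dvd_mul_of_dvd_right hT2 _) _)
      · right
        obtain ⟨t, rfl⟩ := hTm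
        refine ⟨⟨S * κ + A * (m * (2 * t)) * (m * q), by rw [hKe]; ring⟩,
          S * q - 2 * (c * k * t * (k * κ)), ?_, by rw [hMe]; ring⟩
        exact (hSodd.mul hq).sub_even (even_two_mul _)

theorem descent_three_unique {A c : ℤ} (hA : 0 < A) (hA3 : ¬ 3 ∣ A) (hc : 1 < c) (hc3 : ¬ 3 ∣ c)
    {i j y b : ℕ} (hy : 0 < y) (hb : 0 < b) (h₁ : A * (2 ^ i) ^ 2 + c = 3 ^ y)
    (h₂ : A * (2 ^ j) ^ 2 + c = 3 ^ b) : y = b := by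
  classical
  have hex : ∃ n : ℕ, 0 < n ∧ ∃ M K : ℤ, ¬ 3 ∣ K ∧ A * M ^ 2 + c * K ^ 2 = 3 ^ n :=
    ⟨y, hy, 2 ^ i, 1, by decide, by rw [← h₁]; ring⟩
  obtain ⟨hn₀, m, k, hk, hγ⟩ := Nat.find_spec hex
  have main : ∀ (n l : ℕ), 0 < n → A * (2 ^ l) ^ 2 + c = 3 ^ n → n = Nat.find hex := by
    intro n l hn h
    have h' : A * (2 ^ l) ^ 2 + c * 1 ^ 2 = 3 ^ n := by rw [← h]; ring
    rcases descent_three hA hA3 hc hc3 hn₀ hk hγ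
      (fun n M K h0 hlt h3 he => Nat.find_min hex hlt ⟨h0, M, K, h3, he⟩) n _ _ hn
      (by decide) h' with h2 | ⟨hk1, q, hq, hM⟩
    · omega
    · have hk2 : k ^ 2 = 1 := by
        rcases Int.isUnit_iff.1 (isUnit_of_dvd_one hk1) with h | h <;> simp [h]
      have hq2 : q ^ 2 = 1 := by
        have hcop : IsCoprime q (2 ^ l) :=
          (Int.isCoprime_two_right.2 hq).pow_right
        have : IsUnit q := hcop.isUnit_of_dvd' dvd_rfl ⟨m, by rw [hM]; ring⟩
        rcases Int.isUnit_iff.1 this with h | h <;> simp [h]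
      have : (3 : ℤ) ^ n = 3 ^ Nat.find hex := by
        rw [← h', hM, ← hγ, hk2, mul_pow, hq2]; ring
      exact Int.pow_right_injective (by decide) this
  rw [main y i hy h₁, main b j hb h₂]

/-- The congruences satisfied by the coordinates `q, κ` of an odd power `γ ^ j` relative to those
of `γ = (√B + √(B - 4 * 2 ^ n)) / 2`, according to the class of `j` modulo `3`. -/
def CubeResidues (B : ℤ) (n : ℕ) (q κ : ℤ) : Prop :=
  (B - 2 ^ n ∣ q - κ ∧ (3 ∣ B → 3 ∣ q - κ)) ∨ (B - 2 ^ n ∣ q + κ ∧ (3 ∣ B → 3 ∣ q + κ)) ∨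
    (B - 2 ^ n ∣ κ ∧ (3 ∣ B → 3 ∣ q))

theorem CubeResidues.step {B : ℤ} {n : ℕ} (hn : 0 < n) (hB : Odd B) {q κ q' κ' : ℤ}
    (h : CubeResidues B n q' κ') (hq : 2 * q = (B - 2 * 2 ^ n) * q' - (4 * 2 ^ n - B) * κ')
    (hκ : 2 * κ = (B - 2 * 2 ^ n) * κ' + B * q') : CubeResidues B n q κ := by
  have hμ : IsCoprime (B - 2 ^ n) 2 := by
    rw [Int.isCoprime_two_right]
    exact hB.sub_even ((even_two).pow_of_ne_zero hn.ne')
  unfold CubeResidues at *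
  generalize (2 : ℤ) ^ n = e at *
  have half : ∀ x t : ℤ, 2 * x = (B - e) * t → B - e ∣ x :=
    fun x t ht => hμ.dvd_of_dvd_mul_left ⟨t, ht⟩
  have half3 : ∀ x t : ℤ, 2 * x = 3 * t → (3 : ℤ) ∣ x := fun x t ht => by omega
  rcases h with ⟨⟨t, ht⟩, h3⟩ | ⟨⟨t, ht⟩, h3⟩ | ⟨⟨t, ht⟩, h3⟩
  · refine .inr (.inr ⟨half _ (B * t + 2 * κ') ?_, fun hb => ?_⟩)
    · linear_combination hκ + B * ht
    · obtain ⟨b, rfl⟩ := hb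
      obtain ⟨s, hs⟩ := h3 ⟨b, rfl⟩
      exact half3 _ (b * q' + b * κ' - 2 * e * s - 2 * e * κ') (by
        linear_combination hq - 2 * e * hs)
  · refine .inl ⟨half _ (-2 * e * t) ?_, fun hb => ?_⟩
    · linear_combination hq - hκ - 2 * e * ht
    · obtain ⟨b, rfl⟩ := hb
      obtain ⟨s, hs⟩ := h3 ⟨b, rfl⟩
      exact half3 _ (-2 * e * s) (by linear_combination hq - hκ - 2 * e * hs)
  · refine .inr (.inl ⟨half _ (2 * q' + (2 * B - 6 * e) * t) ?_, fun hb => ?_⟩)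
    · linear_combination hq + hκ + (2 * B - 6 * e) * ht
    · obtain ⟨b, rfl⟩ := hb
      obtain ⟨s, hs⟩ := h3 ⟨b, rfl⟩
      exact half3 _ (2 * b * q' - 2 * e * s + 2 * b * κ' - 2 * e * κ') (by
        linear_combination hq + hκ - 2 * e * hs)

theorem descent_two {A c : ℤ} (hA : 0 < A) (hA2 : Odd A) (hc : 4 < c) (hAc : 8 ∣ A + c)
    {n₀ : ℕ} {m k : ℤ} (hn₀ : 0 < n₀) (hm : Odd m) (hk : Odd k)
    (hγ : A * m ^ 2 + c * k ^ 2 = 4 * 2 ^ n₀)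
    (hmin : ∀ (n : ℕ) (M K : ℤ), 0 < n → n < n₀ → Odd M → Odd K →
      A * M ^ 2 + c * K ^ 2 ≠ 4 * 2 ^ n)
    (n : ℕ) : ∀ M K : ℤ, 0 < n → Odd M → Odd K → 4 ∣ K * m - M * k →
      A * M ^ 2 + c * K ^ 2 = 4 * 2 ^ n →
      (A = 1 ∧ m * k ∣ K) ∨ ∃ q κ : ℤ, M = m * q ∧ K = k * κ ∧ CubeResidues (A * m ^ 2) n₀ q κ := by
  have hp := Int.prime_two
  have hc2 : Odd c := by
    obtain ⟨a, ha⟩ := hA2; exact ⟨(c - 1) / 2, by omega⟩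
  have hn2 : (2 : ℤ) ∣ 2 ^ n₀ := dvd_pow_self _ hn₀.ne'
  have sq4 : ∀ x : ℤ, Odd x → ∃ u, x ^ 2 = 1 + 4 * u := by
    rintro x ⟨a, rfl⟩; exact ⟨a ^ 2 + a, by ring⟩
  have cop : ∀ j : ℕ, IsCoprime (2 * (2 : ℤ) ^ j) A := fun j => by
    rw [← pow_succ']
    exact (Int.isCoprime_two_left.2 hA2).pow_left
  -- a product divisible by `4 * 2 ^ j` with one factor twice an odd number
  have split : ∀ (j : ℕ) (x y : ℤ), 4 * (2 : ℤ) ^ j ∣ c * (x * y) → (∃ z, Odd z ∧ y = 2 * z) →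
      2 * (2 : ℤ) ^ j ∣ x := by
    rintro j x _ hd ⟨z, hz, rfl⟩
    have hz' : ¬ (2 : ℤ) ∣ c * z := by
      rw [← even_iff_two_dvd, Int.not_even_iff_odd]; exact hc2.mul hz
    have : (2 : ℤ) ^ (j + 1) ∣ (c * z) * x := by
      obtain ⟨w, hw⟩ := hd
      exact ⟨w, by rw [pow_succ]; linarith⟩
    rw [← pow_succ']
    exact hp.pow_dvd_of_dvd_mul_left _ hz' this
  have sum2 : ∀ M K : ℤ, Odd M → Odd K → 4 ∣ K * m - M * k →
      ∃ z, Odd z ∧ K * m + M * k = 2 * z := by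
    rintro M K hM hK ⟨u, hu⟩
    exact ⟨M * k + 2 * u, (hM.mul hk).add_even (even_two_mul _), by linear_combination hu⟩
  set S := A * m ^ 2 - 2 * 2 ^ n₀ with hS
  obtain ⟨σ, hσ⟩ : ∃ σ, S = A + 4 * σ := by
    obtain ⟨u, hu⟩ := sq4 m hm
    obtain ⟨v, hv⟩ := hn2
    exact ⟨A * u - v, by rw [hS, hu, hv]; ring⟩
  have hS2 : Odd S := by rw [hσ]; exact hA2.add_even ⟨2 * σ, by ring⟩
  have hnorm : S ^ 2 + A * c * (m * k) ^ 2 = 4 * 2 ^ (2 * n₀) := by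
    rw [mul_comm 2 n₀, pow_mul, hS]; linear_combination A * m ^ 2 * hγ
  have odd_of_norm : ∀ (j : ℕ) (M K : ℤ), 0 < j → A * M ^ 2 + c * K ^ 2 = 4 * 2 ^ j →
      ¬ (∃ M' K', M = 2 * M' ∧ K = 2 * K' ∧ Even (M' + K')) → Odd M ∧ Odd K := by
    intro j M K hj h hne
    have hpar : Even (M + K) := by
      have he : Even (A * M ^ 2 + c * K ^ 2) := by rw [h]; exact ⟨2 * 2 ^ j, by ring⟩
      simp only [Int.even_add, Int.even_mul, Int.even_pow' two_ne_zero] at he ⊢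
      simpa [hA2, hc2, Int.not_even_iff_odd.2] using he
    rcases Int.even_or_odd M with hM | hM
    · exfalso
      have hK : Even K := by rwa [Int.even_add, iff_true_left hM] at hpar
      obtain ⟨M', rfl⟩ := hM.two_dvd
      obtain ⟨K', rfl⟩ := hK.two_dvd
      refine hne ⟨M', K', rfl, rfl, ?_⟩
      have he : Even (A * M' ^ 2 + c * K' ^ 2) := by
        rw [show A * M' ^ 2 + c * K' ^ 2 = 2 ^ j by linarith]
        exact even_two.pow_of_ne_zero hj.ne'
      simp only [Int.even_add, Int.even_mul, Int.even_pow' two_ne_zero] at he ⊢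
      simpa [hA2, hc2, Int.not_even_iff_odd.2] using he
    · refine ⟨hM, ?_⟩
      rw [Int.even_add, iff_false_left (Int.not_even_iff_odd.2 hM)] at hpar
      exact Int.not_even_iff_odd.1 hpar
  induction n using Nat.strong_induction_on with
  | _ n ih =>
  intro M K hn hM hK hsim h
  have hTd : 2 * (2 : ℤ) ^ min n (2 * n₀) ∣ K * S - A * M * (m * k) := by
    apply split (y := K * S + A * M * (m * k))
    · have e : c * ((K * S - A * M * (m * k)) * (K * S + A * M * (m * k))) =
          4 * (2 ^ n * S ^ 2 - A * M ^ 2 * 2 ^ (2 * n₀)) := by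
        linear_combination S ^ 2 * h - A * M ^ 2 * hnorm
      rw [e]
      exact mul_dvd_mul_left _ (dvd_sub
        (dvd_mul_of_dvd_left (pow_dvd_pow _ (min_le_left _ _)) _)
        (dvd_mul_of_dvd_right (pow_dvd_pow _ (min_le_right _ _)) _))
    · obtain ⟨u, hu⟩ := hsim
      obtain ⟨v, hv⟩ := sq4 m hm
      refine ⟨A * K + 2 * (K * σ + A * K * v - A * m * u), (hA2.mul hK).add_even (even_two_mul _), ?_⟩
      rw [hσ]; linear_combination A * K * hv - A * m * hu
  rcases lt_trichotomy n n₀ with hlt | rfl | hgt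
  · exact absurd h (hmin n M K hn hlt hM hK)
  · right
    obtain ⟨t, ht⟩ := split n (K * m - M * k) _ ⟨m ^ 2 - M ^ 2, by linear_combination m ^ 2 * h - M ^ 2 * hγ⟩
      (sum2 M K hM hK hsim)
    have e : (A * M * m + c * K * k) ^ 2 + A * c * (K * m - M * k) ^ 2 = 16 * (2 ^ n) ^ 2 := by
      calc _ = (A * M ^ 2 + c * K ^ 2) * (A * m ^ 2 + c * k ^ 2) := by ring
        _ = _ := by rw [h, hγ]; ring
    have hpos : (0 : ℤ) < (2 ^ n) ^ 2 := by positivity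
    have ht0 : t = 0 := by
      by_contra hne
      have h1 : 1 ≤ t ^ 2 := by
        have := sq_pos_of_ne_zero hne
        omega
      have h2 : 4 < A * c := by nlinarith
      have h3 : 4 < A * c * t ^ 2 := by nlinarith
      rw [ht, mul_pow, mul_pow] at e
      nlinarith [sq_nonneg (A * M * m + c * K * k)]
    rw [ht0, mul_zero, sub_eq_zero] at ht
    have hsq : M ^ 2 = m ^ 2 := by
      have hpos : 4 * (2 : ℤ) ^ n ≠ 0 := by positivity
      apply mul_left_cancel₀ hpos
      linear_combination m ^ 2 * h - M ^ 2 * hγ - c * (K * m + M * k) * ht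
    have hm0 : m ≠ 0 := by rintro rfl; exact absurd hm (by decide)
    rcases sq_eq_sq_iff_eq_or_eq_neg.1 hsq with hMm | hMm
    · have hKk : K = k := mul_right_cancel₀ hm0 (by rw [ht, hMm, mul_comm])
      exact ⟨1, 1, by rw [hMm, mul_one], by rw [hKk, mul_one], .inl (by simp)⟩
    · have hKk : K = -k := mul_right_cancel₀ hm0 (by rw [ht, hMm]; ring)
      exact ⟨-1, -1, by rw [hMm]; ring, by rw [hKk]; ring, .inl (by simp)⟩
  rcases lt_or_ge n (2 * n₀) with hlt | hge
  · exfalso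
    rw [min_eq_left hlt.le] at hTd
    obtain ⟨M', K', h', -, -, -, hS'⟩ := exists_quotient (N₃ := 4 * 2 ^ (2 * n₀ - n))
      (by positivity) (cop n) h hnorm
      (by rw [show 2 * n₀ = n + (2 * n₀ - n) by omega, pow_add, Nat.add_sub_cancel_left]; ring) hTd
    have hSe : A * M * M' + c * K * K' = 2 * S := by
      have : 2 * (2 : ℤ) ^ n ≠ 0 := by positivity
      apply mul_left_cancel₀ this
      rw [hS']; ring
    obtain ⟨hM', hK'⟩ := odd_of_norm _ M' K' (by omega) h' (by
      rintro ⟨M'', K'', rfl, rfl, he⟩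
      have : Even S := by
        rw [show S = A * M * M'' + c * K * K'' by linarith]
        simp only [Int.even_add, Int.even_mul] at he ⊢
        simpa [hA2, hc2, hM, hK, Int.not_even_iff_odd.2] using he
      exact Int.not_even_iff_odd.2 hS2 this)
    exact hmin (2 * n₀ - n) M' K' (by omega) (by omega) hM' hK' h'
  · rw [min_eq_right hge] at hTd
    obtain ⟨M', K', h', -, hMe, hKe, -⟩ := exists_quotient (N₃ := 4 * 2 ^ (n - 2 * n₀))
      (by positivity) (cop (2 * n₀)) h hnorm
      (by
        rw [show n = 2 * n₀ + (n - 2 * n₀) by omega, pow_add (2 : ℤ) (2 * n₀) (n - 2 * n₀),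
          Nat.add_sub_cancel_left]; ring) hTd
    have h0 : 2 * (2 : ℤ) ^ (2 * n₀) ≠ 0 := by positivity
    replace hMe : 2 * M = S * M' - c * (m * k) * K' := by
      apply mul_left_cancel₀ h0
      rw [hMe]; ring
    replace hKe : 2 * K = S * K' + A * (m * k) * M' := by
      apply mul_left_cancel₀ h0
      rw [hKe]; ring
    have hmk : IsCoprime (m * k) 2 := Int.isCoprime_two_right.2 (hm.mul hk)
    rcases hge.eq_or_lt with heq | hlt
    · left
      rw [← heq, Nat.sub_self, pow_zero, mul_one] at h'
      have hK0 : K' = 0 := by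
        by_contra hne
        have := sq_pos_of_ne_zero hne
        nlinarith [mul_nonneg hA.le (sq_nonneg M')]
      rw [hK0] at h' hKe
      refine ⟨?_, hmk.dvd_of_dvd_mul_left ⟨A * M', by rw [hKe]; ring⟩⟩
      have hd : A ∣ 2 ^ 2 := ⟨M' ^ 2, by linarith⟩
      have : IsUnit A :=
        ((Int.isCoprime_two_right.2 hA2).pow_right (n := 2)).isUnit_of_dvd' dvd_rfl hd
      rcases Int.isUnit_iff.1 this with h | h <;> omega
    · obtain ⟨hM', hK'⟩ := odd_of_norm _ M' K' (by omega) h' (by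
        rintro ⟨M'', K'', rfl, rfl, he⟩
        have : Even K := by
          rw [show K = S * K'' + A * (m * k) * M'' by linarith]
          simp only [Int.even_add, Int.even_mul] at he ⊢
          simpa [hA2, hS2, hm, hk, Int.not_even_iff_odd.2, iff_comm] using he
        exact Int.not_even_iff_odd.2 hK this)
      have hsim' : 4 ∣ K' * m - M' * k := by
        by_contra hne
        have h4 : 4 ∣ K' * m + M' * k := by
          obtain ⟨a, ha⟩ := hK'.mul hm
          obtain ⟨b, hb⟩ := hM'.mul hk
          omega
        obtain ⟨u, hu⟩ := h4
        obtain ⟨v, hv⟩ := sq4 m hm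
        obtain ⟨a, ha⟩ := hK
        have : 2 * K = 4 * (A * m * u - A * K' * v + σ * K') := by
          rw [hKe, hσ]; linear_combination A * m * hu - A * K' * hv
        omega
      rcases ih (n - 2 * n₀) (by omega) M' K' (by omega) hM' hK' hsim' h' with
        ⟨hA1, hd⟩ | ⟨q', κ', rfl, rfl, hres⟩
      · refine .inl ⟨hA1, hmk.dvd_of_dvd_mul_left ?_⟩
        rw [hKe]
        exact dvd_add (dvd_mul_of_dvd_right hd _)
          (dvd_mul_of_dvd_left (dvd_mul_of_dvd_right dvd_rfl _) _)
      · right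
        have hmd : m ∣ M := (Int.isCoprime_two_right.2 hm).dvd_of_dvd_mul_left
          ⟨S * q' - c * k * (k * κ'), by rw [hMe]; ring⟩
        have hkd : k ∣ K := (Int.isCoprime_two_right.2 hk).dvd_of_dvd_mul_left
          ⟨S * κ' + A * m * (m * q'), by rw [hKe]; ring⟩
        obtain ⟨q, rfl⟩ := hmd
        obtain ⟨κ, rfl⟩ := hkd
        have hm0 : m ≠ 0 := by rintro rfl; exact absurd hm (by decide)
        have hk0 : k ≠ 0 := by rintro rfl; exact absurd hk (by decide)
        refine ⟨q, κ, rfl, rfl, hres.step hn₀ (hA2.mul hm.pow) ?_ ?_⟩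
        · apply mul_left_cancel₀ hm0
          rw [← hS, ← hγ]; linear_combination hMe
        · apply mul_left_cancel₀ hk0
          rw [← hS]; linear_combination hKe

theorem descent_two_three_pow {A c : ℤ} (hA : 0 < A) (hA2 : Odd A) (hc : 4 < c)
    (hAc : 8 ∣ A + c) {n₀ : ℕ} {m k : ℤ} (hn₀ : 0 < n₀) (hm : Odd m) (hk : Odd k)
    (hγ : A * m ^ 2 + c * k ^ 2 = 4 * 2 ^ n₀)
    (hmin : ∀ (n : ℕ) (M K : ℤ), 0 < n → n < n₀ → Odd M → Odd K →
      A * M ^ 2 + c * K ^ 2 ≠ 4 * 2 ^ n)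
    {n l : ℕ} (hn : 0 < n) (h : A * (3 ^ l) ^ 2 + c = 4 * 2 ^ n) :
    k ^ 2 = 1 ∧ m ∣ 3 ^ l ∧
      (n = n₀ ∨ (A = 1 ∧ m ^ 2 = 1) ∨ (3 ∣ A * m ^ 2 → A * m ^ 2 - 2 ^ n₀ ∣ 1)) := by
  have sq_one : ∀ {x : ℤ}, x ∣ 1 → x ^ 2 = 1 := fun hx => by
    rcases Int.isUnit_iff.1 (isUnit_of_dvd_one hx) with h | h <;> simp [h]
  have hM : Odd ((3 : ℤ) ^ l) := Odd.pow (by decide)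
  obtain ⟨K, hK, hsim⟩ : ∃ K : ℤ, (K = 1 ∨ K = -1) ∧ 4 ∣ K * m - 3 ^ l * k := by
    obtain ⟨u, hu⟩ := hM.mul hk
    obtain ⟨v, hv⟩ := hm
    rcases Int.emod_two_eq_zero_or_one (u - v) with h0 | h0
    · exact ⟨1, .inl rfl, by omega⟩
    · exact ⟨-1, .inr rfl, by omega⟩
  have hK1 : K ∣ 1 := by rcases hK with rfl | rfl <;> simp
  have hK2 : Odd K := by rcases hK with rfl | rfl <;> decide
  have h' : A * (3 ^ l) ^ 2 + c * K ^ 2 = 4 * 2 ^ n := by rw [sq_one hK1, mul_one, h]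
  rcases descent_two hA hA2 hc hAc hn₀ hm hk hγ hmin n _ K hn hM hK2 hsim h' with
    ⟨hA1, hd⟩ | ⟨q, κ, hMq, rfl, hres⟩
  · have hm1 : m ∣ 1 := (dvd_of_mul_right_dvd hd).trans hK1
    exact ⟨sq_one ((dvd_of_mul_left_dvd hd).trans hK1), hm1.trans (one_dvd _),
      .inr (.inl ⟨hA1, sq_one hm1⟩)⟩
  · have hκ1 : κ ∣ 1 := (dvd_mul_left _ _).trans hK1
    have hk1 := sq_one ((dvd_mul_right k κ).trans hK1)
    refine ⟨hk1, ⟨q, hMq⟩, ?_⟩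
    by_cases h3 : (3 : ℤ) ∣ q
    · refine .inr (.inr fun hB => ?_)
      have hκ3 : ¬ (3 : ℤ) ∣ κ := fun h => by have := h.trans hκ1; omega
      rcases hres with ⟨-, h⟩ | ⟨-, h⟩ | ⟨h, -⟩
      · have := h hB; omega
      · have := h hB; omega
      · exact h.trans hκ1
    · left
      have hcop : IsCoprime q (3 ^ l) :=
        ((Int.prime_three.coprime_iff_not_dvd.2 h3).symm).pow_right
      have hq : q ^ 2 = 1 := by
        rcases Int.isUnit_iff.1 (hcop.isUnit_of_dvd' dvd_rfl ⟨m, by rw [hMq]; ring⟩) with h | h <;>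
          simp [h]
      have : 4 * (2 : ℤ) ^ n = 4 * 2 ^ n₀ := by
        rw [← h, ← hγ, hMq, mul_pow, hq, hk1]; ring
      exact Int.pow_right_injective (by decide) (mul_left_cancel₀ (by norm_num) this)

theorem two_pow_sub_three_pow_cases {A c : ℤ} (hA : A = 1 ∨ A = 3) (hc : 4 < c) {i j n n' : ℕ}
    (hn : 0 < n) (hnn' : n < n') (h₁ : A * (3 ^ i) ^ 2 + c = 4 * 2 ^ n)
    (h₂ : A * (3 ^ j) ^ 2 + c = 4 * 2 ^ n') :
    (∃ r : ℕ, c + 1 = 4 * 2 ^ r) ∨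
      ∃ z r : ℕ, c + 3 ^ z = 4 * 2 ^ r ∧ ((3 : ℤ) ^ z = 2 ^ r + 1 ∨ (2 : ℤ) ^ r = 3 ^ z + 1) := by
  classical
  have hA0 : 0 < A := by omega
  have hA2 : Odd A := by rcases hA with rfl | rfl <;> decide
  have hAc : 8 ∣ A + c := by
    have h9 : (8 : ℤ) ∣ 9 ^ i - 1 := by simpa using sub_dvd_pow_sub_pow (9 : ℤ) 1 i
    have h2 : (2 : ℤ) ∣ 2 ^ n := dvd_pow_self _ hn.ne'
    rw [← pow_mul, mul_comm i 2, pow_mul] at h₁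
    norm_num at h₁
    rcases hA with rfl | rfl <;> omega
  have hex : ∃ n : ℕ, 0 < n ∧ ∃ m k : ℤ, Odd m ∧ Odd k ∧ A * m ^ 2 + c * k ^ 2 = 4 * 2 ^ n :=
    ⟨n, hn, 3 ^ i, 1, Odd.pow (by decide), by decide, by rw [← h₁]; ring⟩
  obtain ⟨hn₀, m, k, hm, hk, hγ⟩ := Nat.find_spec hex
  have hmin : ∀ (n : ℕ) (M K : ℤ), 0 < n → n < Nat.find hex → Odd M → Odd K →
      A * M ^ 2 + c * K ^ 2 ≠ 4 * 2 ^ n := fun n M K h0 hlt hM hK he =>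
    Nat.find_min hex hlt ⟨h0, M, K, hM, hK, he⟩
  obtain ⟨hk1, hmd, h1⟩ := descent_two_three_pow hA0 hA2 hc hAc hn₀ hm hk hγ hmin hn h₁
  obtain ⟨-, -, h2⟩ :=
    descent_two_three_pow hA0 hA2 hc hAc hn₀ hm hk hγ hmin (hn.trans hnn') h₂
  generalize Nat.find hex = n₀ at *
  rw [hk1, mul_one] at hγ
  obtain ⟨z, hz⟩ : ∃ z : ℕ, A * m ^ 2 = 3 ^ z := by
    obtain ⟨s, -, hs⟩ := (Nat.dvd_prime_pow Nat.prime_three).1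
      (by simpa [Int.natAbs_pow] using Int.natAbs_dvd_natAbs.2 hmd : m.natAbs ∣ 3 ^ i)
    have hm2 : m ^ 2 = 3 ^ (2 * s) := by
      rw [← Int.natAbs_sq, hs]; push_cast; rw [← pow_mul, mul_comm]
    rcases hA with rfl | rfl
    · exact ⟨2 * s, by rw [hm2, one_mul]⟩
    · exact ⟨2 * s + 1, by rw [hm2, pow_succ']⟩
  rw [hz] at hγ h1 h2
  rcases Nat.eq_zero_or_pos z with rfl | hz0
  · exact .inl ⟨n₀, by rw [← hγ]; ring⟩
  · right
    have h3 : (3 : ℤ) ∣ 3 ^ z := dvd_pow_self _ hz0.ne'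
    have hA1 : ¬ (A = 1 ∧ m ^ 2 = 1) := by
      rintro ⟨rfl, hm1⟩
      rw [hm1] at hz
      omega
    have hμ : (3 : ℤ) ^ z - 2 ^ n₀ ∣ 1 := by
      rcases h1 with h1 | h1 | h1
      · rcases h2 with h2 | h2 | h2
        · omega
        · exact absurd h2 hA1
        · exact h2 h3
      · exact absurd h1 hA1
      · exact h1 h3
    refine ⟨z, n₀, by rw [← hγ]; ring, ?_⟩
    rcases Int.isUnit_iff.1 (isUnit_of_dvd_one hμ) with h | h <;> omega

theorem pow_mod_of_period {g N m : ℕ} (h : g ^ N % m = 1 % m) (b : ℕ) :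
    g ^ b % m = g ^ (b % N) % m := by
  conv_lhs => rw [← Nat.div_add_mod b N, pow_add, pow_mul, Nat.mul_mod, Nat.pow_mod, h]
  rw [← Nat.pow_mod, one_pow, ← Nat.mul_mod, one_mul]

theorem three_pow_eq_two_pow_add_one {x b : ℕ} (h : 3 ^ b = 2 ^ x + 1) :
    x = 1 ∧ b = 1 ∨ x = 3 ∧ b = 2 := by
  rcases lt_or_ge x 4 with hx | hx
  · have hb : b < 4 := by
      have : (2 : ℕ) ^ x < 2 ^ 4 := Nat.pow_lt_pow_right (by norm_num) hx
      exact (Nat.pow_lt_pow_iff_right (by norm_num : 1 < 3)).1 (by omega)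
    interval_cases x <;> interval_cases b <;> omega
  · exfalso
    have h1 : 3 ^ b % 16 = 1 := by
      obtain ⟨k, rfl⟩ := Nat.exists_eq_add_of_le hx
      rw [h, pow_add]; omega
    rw [pow_mod_of_period (N := 4) (by norm_num)] at h1
    have h2 := pow_mod_of_period (g := 3) (N := 4) (m := 5) (by norm_num) b
    have h3 := pow_mod_of_period (g := 2) (N := 4) (m := 5) (by norm_num) x
    have : b % 4 < 4 := Nat.mod_lt _ (by norm_num)
    have : x % 4 < 4 := Nat.mod_lt _ (by norm_num)
    generalize b % 4 = r at *
    generalize x % 4 = s at *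
    interval_cases r <;> interval_cases s <;> omega

theorem two_pow_eq_three_pow_add_one {x b : ℕ} (h : 2 ^ x = 3 ^ b + 1) :
    x = 1 ∧ b = 0 ∨ x = 2 ∧ b = 1 := by
  rcases lt_or_ge x 3 with hx | hx
  · have hb : b < 2 := by
      have : (2 : ℕ) ^ x < 2 ^ 3 := Nat.pow_lt_pow_right (by norm_num) hx
      exact (Nat.pow_lt_pow_iff_right (by norm_num : 1 < 3)).1 (by omega)
    interval_cases x <;> interval_cases b <;> omega
  · exfalso
    have h1 : (3 ^ b + 1) % 8 = 0 := by
      obtain ⟨k, rfl⟩ := Nat.exists_eq_add_of_le hx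
      rw [← h, pow_add]; omega
    rw [Nat.add_mod, pow_mod_of_period (N := 2) (by norm_num)] at h1
    have : b % 2 < 2 := Nat.mod_lt _ (by norm_num)
    generalize b % 2 = r at *
    interval_cases r <;> omega

/-- A congruence obstruction to `2 ^ x = 3 ^ b + c` with `x ≥ X`, from the moduli `2 ^ X`
and `p`. -/
theorem lt_of_two_pow_eq_three_pow_add {c X N N' p x b : ℕ} (hN : 0 < N) (hN' : 0 < N')
    (hX : 3 ^ N % 2 ^ X = 1 % 2 ^ X) (hp : 3 ^ N % p = 1 % p) (hp' : 2 ^ N' % p = 1 % p)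
    (hno : ∀ r < N, (3 ^ r + c) % 2 ^ X = 0 → ∀ s < N', 2 ^ s % p ≠ (3 ^ r + c) % p)
    (h : 2 ^ x = 3 ^ b + c) : x < X := by
  by_contra! hx
  have key : ∀ m, 3 ^ N % m = 1 % m → (3 ^ b + c) % m = (3 ^ (b % N) + c) % m := fun m hm => by
    rw [Nat.add_mod, pow_mod_of_period hm, ← Nat.add_mod]
  refine hno (b % N) (Nat.mod_lt _ hN) ?_ (x % N') (Nat.mod_lt _ hN') ?_
  · rw [← key _ hX, ← h]
    exact Nat.mod_eq_zero_of_dvd (pow_dvd_pow _ hx)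
  · rw [← pow_mod_of_period hp', h, key _ hp]

theorem two_pow_eq_three_pow_add_five {x b : ℕ} (h : 2 ^ x = 3 ^ b + 5) :
    x = 3 ∧ b = 1 ∨ x = 5 ∧ b = 3 := by
  have hx : x < 6 := lt_of_two_pow_eq_three_pow_add (N := 16) (N' := 8) (p := 17)
    (by norm_num) (by norm_num) (by norm_num) (by norm_num) (by norm_num) (by decide) h
  have hb : b < 4 := by
    have : (2 : ℕ) ^ x < 2 ^ 6 := Nat.pow_lt_pow_right (by norm_num) hx
    exact (Nat.pow_lt_pow_iff_right (by norm_num : 1 < 3)).1 (by omega)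
  interval_cases x <;> interval_cases b <;> omega

theorem two_pow_eq_three_pow_add_seven {x b : ℕ} (h : 2 ^ x = 3 ^ b + 7) :
    x = 3 ∧ b = 0 ∨ x = 4 ∧ b = 2 := by
  have hx : x < 5 := lt_of_two_pow_eq_three_pow_add (N := 16) (N' := 8) (p := 85)
    (by norm_num) (by norm_num) (by norm_num) (by norm_num) (by norm_num) (by decide) h
  have hb : b < 4 := by
    have : (2 : ℕ) ^ x < 2 ^ 5 := Nat.pow_lt_pow_right (by norm_num) hx
    exact (Nat.pow_lt_pow_iff_right (by norm_num : 1 < 3)).1 (by omega)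
  interval_cases x <;> interval_cases b <;> omega

theorem two_pow_eq_three_pow_add_thirteen {x b : ℕ} (h : 2 ^ x = 3 ^ b + 13) :
    x = 4 ∧ b = 1 ∨ x = 8 ∧ b = 5 := by
  have hx : x < 9 := lt_of_two_pow_eq_three_pow_add (N := 256) (N' := 16) (p := 257)
    (by norm_num) (by norm_num) (by norm_num) (by norm_num) (by norm_num) (by decide +kernel) h
  have hb : b < 6 := by
    have : (2 : ℕ) ^ x < 2 ^ 9 := Nat.pow_lt_pow_right (by norm_num) hx
    exact (Nat.pow_lt_pow_iff_right (by norm_num : 1 < 3)).1 (by omega)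
  interval_cases x <;> interval_cases b <;> omega

theorem two_pow_eq_three_pow_add_twentythree {x b : ℕ} (h : 2 ^ x = 3 ^ b + 23) :
    x = 5 ∧ b = 2 := by
  have hx : x < 6 := lt_of_two_pow_eq_three_pow_add (N := 16) (N' := 8) (p := 17)
    (by norm_num) (by norm_num) (by norm_num) (by norm_num) (by norm_num) (by decide) h
  have hb : b < 4 := by
    have : (2 : ℕ) ^ x < 2 ^ 6 := Nat.pow_lt_pow_right (by norm_num) hx
    exact (Nat.pow_lt_pow_iff_right (by norm_num : 1 < 3)).1 (by omega)
  interval_cases x <;> interval_cases b <;> omega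

theorem le_three_of_two_pow_add_three_pow {r x b : ℕ} (hrx : r < x)
    (h : 2 ^ r + 3 ^ b = 2 ^ x + 1) : r ≤ 3 := by
  by_contra! hr
  have hb0 : b ≠ 0 := by
    rintro rfl
    have := Nat.pow_right_injective le_rfl (Nat.add_right_cancel h)
    omega
  have hr16 : 2 ^ 4 ∣ 2 ^ r := pow_dvd_pow 2 hr
  have hx16 : 2 ^ 4 ∣ 2 ^ x := pow_dvd_pow 2 (by omega)
  have h16 : 3 ^ b % 16 = 1 := by omega
  have h80 := pow_mod_of_period (g := 3) (N := 4) (m := 80) (by norm_num) b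
  have h3 : 3 ^ b % 3 = 0 := Nat.mod_eq_zero_of_dvd (dvd_pow_self 3 hb0)
  have hr15 := pow_mod_of_period (g := 2) (N := 4) (m := 15) (by norm_num) r
  have hx15 := pow_mod_of_period (g := 2) (N := 4) (m := 15) (by norm_num) x
  have : b % 4 < 4 := Nat.mod_lt _ (by norm_num)
  have : r % 4 < 4 := Nat.mod_lt _ (by norm_num)
  have : x % 4 < 4 := Nat.mod_lt _ (by norm_num)
  generalize b % 4 = s at *
  generalize r % 4 = t at *
  generalize x % 4 = u at *
  interval_cases s <;> interval_cases t <;> interval_cases u <;> omega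

theorem exists_sq_decomposition {y b p : ℕ} (h : y % 2 = b % 2) :
    ∃ A i j, (A = 1 ∨ A = p) ∧ p ^ y = A * (p ^ i) ^ 2 ∧ p ^ b = A * (p ^ j) ^ 2 := by
  refine ⟨p ^ (y % 2), y / 2, b / 2, ?_, ?_, ?_⟩
  · rcases Nat.mod_two_eq_zero_or_one y with h | h <;> simp [h]
  · rw [← pow_mul, ← pow_add]; congr 1; omega
  · rw [← pow_mul, ← pow_add]; congr 1; omega

theorem two_pow_add_three_pow_of_lt {x y a b : ℕ} (hx : a < x) (h : 2 ^ x + 3 ^ y = 2 ^ a + 3 ^ b) :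
    x = 2 ∧ y = 0 ∨ x = 3 ∧ y = 1 ∨ x = 4 ∧ y = 0 ∨ x = 5 ∧ y = 1 ∨ x = 8 ∧ y = 1 := by
  have hxa : 2 ^ a < 2 ^ x := Nat.pow_lt_pow_right (by norm_num) hx
  have hyb : y < b := (Nat.pow_lt_pow_iff_right (by norm_num : 1 < 3)).1 (by omega)
  have ha : a ≠ 0 := by
    rintro rfl
    have h2 : 2 ∣ 2 ^ x := dvd_pow_self _ (by omega)
    have h3 : ∀ n, 3 ^ n % 2 = 1 := fun n => by simp [Nat.pow_mod]
    have := h3 y; have := h3 b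
    omega
  have h2a : 2 ∣ 2 ^ a := dvd_pow_self _ ha
  have h3y : 3 ^ y % 2 = 1 := by simp [Nat.pow_mod]
  rcases lt_or_ge (2 ^ a) (3 ^ y) with hlt | hge
  · obtain ⟨d, hd⟩ := Nat.exists_eq_add_of_lt hlt
    have hy : y ≠ 0 := by rintro rfl; have := Nat.one_le_two_pow (n := a); omega
    by_cases hd0 : d = 0
    · subst hd0
      have := three_pow_eq_two_pow_add_one (x := a) (b := y) (by omega)
      have := three_pow_eq_two_pow_add_one (x := x) (b := b) (by omega)
      omega
    · exfalso
      have h3 : 3 ∣ 3 ^ y := dvd_pow_self _ hy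
      have h3b : 3 ∣ 3 ^ b := dvd_pow_self _ (by omega)
      have hx3 := pow_mod_of_period (g := 2) (N := 2) (m := 3) (by norm_num) x
      have ha3 := pow_mod_of_period (g := 2) (N := 2) (m := 3) (by norm_num) a
      have hpar : a % 2 = x % 2 := by
        rcases Nat.mod_two_eq_zero_or_one x with h1 | h1 <;>
          rcases Nat.mod_two_eq_zero_or_one a with h2 | h2 <;> rw [h1] at hx3 <;>
          rw [h2] at ha3 <;> omega
      have ha30 : ¬ 3 ∣ 2 ^ a := by
        rcases Nat.mod_two_eq_zero_or_one a with h2 | h2 <;> rw [h2] at ha3 <;> omega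
      obtain ⟨A, i, j, hA, hi, hj⟩ := exists_sq_decomposition (p := 2) hpar
      have hi' : (2 : ℤ) ^ a = A * (2 ^ i) ^ 2 := by exact_mod_cast hi
      have hj' : (2 : ℤ) ^ x = A * (2 ^ j) ^ 2 := by exact_mod_cast hj
      zify at hd h ha30 h3
      have := descent_three_unique (A := A) (c := d + 1) (i := i) (j := j) (y := y) (b := b)
        (by omega) (by omega) (by omega) (by omega) (by omega) (by omega)
        (by rw [← hi', hd]; ring) (by rw [← hj']; linarith)
      omega
  · obtain ⟨c, hc⟩ := Nat.exists_eq_add_of_le hge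
    have hxc : 2 ^ x = 3 ^ b + c := by omega
    have small : c = 1 ∨ c = 3 ∨ c = 5 ∨ c = 7 ∨ c = 13 ∨ c = 23 := by
      by_cases ha3 : a < 3
      · have : 3 ^ 0 ≤ 3 ^ y := Nat.pow_le_pow_right (by norm_num) (by omega)
        interval_cases a <;> omega
      have ha8 : 2 ^ 3 ∣ 2 ^ a := pow_dvd_pow 2 (by omega)
      have hx8 : 2 ^ 3 ∣ 2 ^ x := pow_dvd_pow 2 (by omega)
      have hy8 := pow_mod_of_period (g := 3) (N := 2) (m := 8) (by norm_num) y
      have hb8 := pow_mod_of_period (g := 3) (N := 2) (m := 8) (by norm_num) b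
      have hpar : y % 2 = b % 2 ∧ 4 < c := by
        rcases Nat.mod_two_eq_zero_or_one y with h1 | h1 <;>
          rcases Nat.mod_two_eq_zero_or_one b with h2 | h2 <;> rw [h1] at hy8 <;>
          rw [h2] at hb8 <;> omega
      obtain ⟨A, i, j, hA, hi, hj⟩ := exists_sq_decomposition (p := 3) hpar.1
      obtain ⟨n, rfl⟩ : ∃ n, a = 2 + n := Nat.exists_eq_add_of_le (by omega)
      obtain ⟨n', rfl⟩ : ∃ n', x = 2 + n' := Nat.exists_eq_add_of_le (by omega)
      rcases two_pow_sub_three_pow_cases (A := A) (c := c) (i := i) (j := j) (n := n) (n' := n')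
        (by omega) (by omega) (by omega) (by omega)
        (by rw [hi, pow_add] at hc; exact_mod_cast hc.symm)
        (by rw [hj, pow_add] at hxc; exact_mod_cast hxc.symm) with ⟨r, hr⟩ | ⟨z, r, hr, hz⟩
      · have hr' : c + 1 = 2 ^ (r + 2) := by rw [pow_add]; zify; linarith
        have hlt : r + 2 < 2 + n' := by
          have : 3 ^ 1 ≤ 3 ^ b := Nat.pow_le_pow_right (by norm_num) (by omega)
          exact (Nat.pow_lt_pow_iff_right (by norm_num : 1 < 2)).1 (by omega)
        have := le_three_of_two_pow_add_three_pow (b := b) hlt (by omega)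
        have : r ≤ 1 := by omega
        interval_cases r <;> omega
      · rcases hz with hz | hz
        · rcases three_pow_eq_two_pow_add_one (by exact_mod_cast hz) with ⟨rfl, rfl⟩ | ⟨rfl, rfl⟩ <;>
            omega
        · rcases two_pow_eq_three_pow_add_one (by exact_mod_cast hz) with ⟨rfl, rfl⟩ | ⟨rfl, rfl⟩ <;>
            omega
    rw [add_comm] at hc
    rcases small with rfl | rfl | rfl | rfl | rfl | rfl
    · have := two_pow_eq_three_pow_add_one hxc
      have := two_pow_eq_three_pow_add_one (x := a) (b := y) (by omega)
      omega
    · exfalso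
      have h3 : 3 ∣ 2 ^ x := by
        rw [hxc]
        exact dvd_add (dvd_pow_self 3 (by omega)) dvd_rfl
      have := Nat.prime_three.dvd_of_dvd_pow h3
      omega
    · have := two_pow_eq_three_pow_add_five hxc
      have := two_pow_eq_three_pow_add_five (x := a) (b := y) (by omega)
      omega
    · have := two_pow_eq_three_pow_add_seven hxc
      have := two_pow_eq_three_pow_add_seven (x := a) (b := y) (by omega)
      omega
    · have := two_pow_eq_three_pow_add_thirteen hxc
      have := two_pow_eq_three_pow_add_thirteen (x := a) (b := y) (by omega)
      omega
    · have := two_pow_eq_three_pow_add_twentythree hxc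
      have := two_pow_eq_three_pow_add_twentythree (x := a) (b := y) (by omega)
      omega

theorem duplicate_reps (n : ℕ) (hn : 0 < n) :
    (∃ x y a b : ℕ, (x, y) ≠ (a, b) ∧ n = 2 ^ x + 3 ^ y ∧ n = 2 ^ a + 3 ^ b) ↔
      n = 5 ∨ n = 11 ∨ n = 17 ∨ n = 35 ∨ n = 259 := by
  constructor
  · rintro ⟨x, y, a, b, hne, h₁, h₂⟩
    rcases lt_trichotomy x a with hlt | rfl | hlt
    · rcases two_pow_add_three_pow_of_lt hlt (h₂.symm.trans h₁) with
        ⟨rfl, rfl⟩ | ⟨rfl, rfl⟩ | ⟨rfl, rfl⟩ | ⟨rfl, rfl⟩ | ⟨rfl, rfl⟩ <;> omega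
    · have : y = b := Nat.pow_right_injective (by norm_num : 2 ≤ 3) (by simp only; omega)
      exact absurd (by rw [this]) hne
    · rcases two_pow_add_three_pow_of_lt hlt (h₁.symm.trans h₂) with
        ⟨rfl, rfl⟩ | ⟨rfl, rfl⟩ | ⟨rfl, rfl⟩ | ⟨rfl, rfl⟩ | ⟨rfl, rfl⟩ <;> omega
  · rintro (rfl | rfl | rfl | rfl | rfl)
    · exact ⟨2, 0, 1, 1, by decide, by norm_num, by norm_num⟩
    · exact ⟨3, 1, 1, 2, by decide, by norm_num, by norm_num⟩
    · exact ⟨4, 0, 3, 2, by decide, by norm_num, by norm_num⟩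
    · exact ⟨5, 1, 3, 3, by decide, by norm_num, by norm_num⟩
    · exact ⟨8, 1, 4, 5, by decide, by norm_num, by norm_num⟩
end

section
/- The only solutions to 2^x + 3^y = 2^a + 3^b with x, y, a, b positive integers and x > a are (x,y,a,b) = (3,1,1,2), (5,1,3,3), and (8,1,4,5), giving the values 11, 35, and 259. -/
open QuadraticAlgebra in
/-- The Lucas sequence of the first kind: the coefficient of `ω` in `ω ^ n`, where
`ω ^ 2 = P * ω - Q`. -/
def lucasU (P Q : ℤ) (n : ℕ) : ℤ := ((ω : QuadraticAlgebra ℤ (-Q) P) ^ n).im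

open QuadraticAlgebra in
/-- The Lucas sequence of the second kind: the trace of `ω ^ n`, where `ω ^ 2 = P * ω - Q`. -/
def lucasV (P Q : ℤ) (n : ℕ) : ℤ := trace ((ω : QuadraticAlgebra ℤ (-Q) P) ^ n)

open QuadraticAlgebra in
theorem lucasV_sq_add (P Q : ℤ) (n : ℕ) :
    lucasV P Q n ^ 2 + (4 * Q - P ^ 2) * lucasU P Q n ^ 2 = 4 * Q ^ n := by
  have h : norm ((ω : QuadraticAlgebra ℤ (-Q) P) ^ n) = Q ^ n := by
    rw [map_pow]
    simp [norm_def]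
  rw [norm_def] at h
  simp only [lucasV, lucasU, trace_def]
  linear_combination 4 * h

open QuadraticAlgebra in
theorem im_pow_eq_mul_lucasU {a b : ℤ} (z : QuadraticAlgebra ℤ a b) (n : ℕ) :
    (z ^ n).im = z.im * lucasU (trace z) (norm z) n := by
  suffices h : (z ^ n).im = z.im * lucasU (trace z) (norm z) n ∧
      (z ^ n).re = ((ω : QuadraticAlgebra ℤ (-norm z) (trace z)) ^ n).re
        + z.re * lucasU (trace z) (norm z) n from h.1
  induction n with
  | zero => simp [lucasU, re_one, im_one]
  | succ n ih =>
    obtain ⟨h₁, h₂⟩ := ih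
    unfold lucasU at *
    simp only [pow_succ, re_mul, im_mul, h₁, h₂, omega_re, omega_im]
    rw [trace_def, norm_def]
    constructor <;> ring

theorem lucasU_mul (P Q : ℤ) (k n : ℕ) :
    lucasU P Q (k * n) = lucasU P Q k * lucasU (lucasV P Q k) (Q ^ k) n := by
  have h := im_pow_eq_mul_lucasU ((QuadraticAlgebra.omega : QuadraticAlgebra ℤ (-Q) P) ^ k) n
  rw [← pow_mul, map_pow QuadraticAlgebra.norm] at h
  have hQ : QuadraticAlgebra.norm (QuadraticAlgebra.omega : QuadraticAlgebra ℤ (-Q) P) = Q := by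
    simp [QuadraticAlgebra.norm_def]
  rw [hQ] at h
  exact h

theorem lucasU_zero (P Q : ℤ) : lucasU P Q 0 = 0 := by
  simp [lucasU, QuadraticAlgebra.im_one]

theorem lucasU_one (P Q : ℤ) : lucasU P Q 1 = 1 := by
  simp [lucasU]

theorem lucasU_add_two (P Q : ℤ) (n : ℕ) :
    lucasU P Q (n + 2) = P * lucasU P Q (n + 1) - Q * lucasU P Q n := by
  simp only [lucasU, pow_succ, QuadraticAlgebra.im_mul, QuadraticAlgebra.re_mul,
    QuadraticAlgebra.omega_re, QuadraticAlgebra.omega_im]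
  ring

theorem lucasV_eq (P Q : ℤ) (n : ℕ) :
    lucasV P Q n = 2 * lucasU P Q (n + 1) - P * lucasU P Q n := by
  simp only [lucasU, lucasV, QuadraticAlgebra.trace_def, pow_succ, QuadraticAlgebra.im_mul,
    QuadraticAlgebra.omega_re, QuadraticAlgebra.omega_im]
  ring

theorem lucasU_two_mul (P Q : ℤ) (n : ℕ) :
    lucasU P Q (2 * n) = lucasU P Q n * lucasV P Q n := by
  rw [mul_comm 2 n, lucasU_mul, lucasU_add_two, lucasU_one, lucasU_zero]
  ring

theorem lucasU_three_mul (P Q : ℤ) (n : ℕ) :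
    lucasU P Q (3 * n) =
      lucasU P Q n * (3 * Q ^ n - (4 * Q - P ^ 2) * lucasU P Q n ^ 2) := by
  rw [mul_comm 3 n, lucasU_mul, lucasU_add_two, lucasU_add_two, lucasU_one, lucasU_zero]
  linear_combination lucasU P Q n * lucasV_sq_add P Q n

theorem sub_one_mul_lucasU (X : ℤ) (n : ℕ) : (X - 1) * lucasU (X + 1) X n = X ^ n - 1 := by
  induction n using Nat.twoStepInduction with
  | zero => simp [lucasU_zero]
  | one => simp [lucasU_one]
  | more n h₀ h₁ =>
    rw [lucasU_add_two]
    linear_combination (X + 1) * h₁ - X * h₀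

theorem dvd_lucasU_succ_sub_pow {p P Q : ℤ} (h : p ∣ Q) (n : ℕ) :
    p ∣ lucasU P Q (n + 1) - P ^ n := by
  induction n with
  | zero => simp [lucasU_one]
  | succ n ih =>
    rw [lucasU_add_two]
    have : P * lucasU P Q (n + 1) - Q * lucasU P Q n - P ^ (n + 1) =
      P * (lucasU P Q (n + 1) - P ^ n) - Q * lucasU P Q n := by ring
    rw [this]
    exact dvd_sub (ih.mul_left _) (h.mul_right _)

theorem dvd_lucasV_succ_sub_pow {p P Q : ℤ} (h : p ∣ Q) (n : ℕ) :
    p ∣ lucasV P Q (n + 1) - P ^ (n + 1) := by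
  have : lucasV P Q (n + 1) - P ^ (n + 1) =
      2 * (lucasU P Q (n + 1 + 1) - P ^ (n + 1)) - P * (lucasU P Q (n + 1) - P ^ n) := by
    rw [lucasV_eq]
    ring
  rw [this]
  exact dvd_sub ((dvd_lucasU_succ_sub_pow h _).mul_left _)
    ((dvd_lucasU_succ_sub_pow h _).mul_left _)

theorem Prime.not_dvd_lucasU {p P Q : ℤ} (hp : Prime p) (hQ : p ∣ Q) (hP : ¬ p ∣ P) {n : ℕ}
    (hn : n ≠ 0) : ¬ p ∣ lucasU P Q n := by
  obtain ⟨n, rfl⟩ := Nat.exists_eq_succ_of_ne_zero hn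
  intro h
  exact hP (hp.dvd_of_dvd_pow ((dvd_iff_dvd_of_dvd_sub (dvd_lucasU_succ_sub_pow hQ n)).1 h))

theorem Prime.not_dvd_lucasV {p P Q : ℤ} (hp : Prime p) (hQ : p ∣ Q) (hP : ¬ p ∣ P) {n : ℕ}
    (hn : n ≠ 0) : ¬ p ∣ lucasV P Q n := by
  obtain ⟨n, rfl⟩ := Nat.exists_eq_succ_of_ne_zero hn
  intro h
  exact hP (hp.dvd_of_dvd_pow ((dvd_iff_dvd_of_dvd_sub (dvd_lucasV_succ_sub_pow hQ n)).1 h))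

theorem dvd_mul_lucasU_sub {p P Q u : ℤ} (hP : p ∣ P - 2 * u) (hQ : p ∣ Q - u ^ 2) (n : ℕ) :
    p ∣ u * lucasU P Q n - n * u ^ n := by
  induction n using Nat.twoStepInduction with
  | zero => simp [lucasU_zero]
  | one => simp [lucasU_one]
  | more n h₀ h₁ =>
    have : u * lucasU P Q (n + 2) - ((n + 2 : ℕ) : ℤ) * u ^ (n + 2) =
        P * (u * lucasU P Q (n + 1) - ((n + 1 : ℕ) : ℤ) * u ^ (n + 1))
          - Q * (u * lucasU P Q n - n * u ^ n)
          + ((n + 1) * u ^ (n + 1) * (P - 2 * u) - n * u ^ n * (Q - u ^ 2)) := by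
      rw [lucasU_add_two]
      push_cast
      ring
    rw [this]
    exact dvd_add (dvd_sub (h₁.mul_left _) (h₀.mul_left _))
      (dvd_sub (hP.mul_left _) (hQ.mul_left _))

theorem Prime.dvd_of_dvd_lucasU {p P Q u : ℤ} (hp : Prime p) (hu : ¬ p ∣ u)
    (hP : p ∣ P - 2 * u) (hQ : p ∣ Q - u ^ 2) {n : ℕ} (h : p ∣ lucasU P Q n) : p ∣ (n : ℤ) := by
  have h' := (dvd_iff_dvd_of_dvd_sub (dvd_mul_lucasU_sub hP hQ n)).1 (h.mul_left u)
  exact (hp.dvd_or_dvd h').resolve_right fun h'' => hu (hp.dvd_of_dvd_pow h'')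

theorem two_pow_dvd_of_dvd_mul_lucasU {P Q : ℤ} (hP : Odd P) (hQ : Odd Q) {f : ℕ} (g : ℤ)
    (n : ℕ) (h : 2 ^ f ∣ g * lucasU (2 * P) Q n) : 2 ^ f ∣ g * n := by
  induction n using Nat.strong_induction_on generalizing g with
  | _ n ih =>
  have hp : Prime (2 : ℤ) := Int.prime_two
  by_cases h2 : (2 : ℤ) ∣ n
  · obtain ⟨k, rfl⟩ : 2 ∣ n := by exact_mod_cast h2
    rcases Nat.eq_zero_or_pos k with rfl | hk
    · simp
    have hV := lucasV_sq_add (2 * P) Q k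
    obtain ⟨W, hW⟩ : (2 : ℤ) ∣ lucasV (2 * P) Q k := by
      apply hp.dvd_of_dvd_pow (n := 2)
      exact ⟨2 * Q ^ k - 2 * (Q - P ^ 2) * lucasU (2 * P) Q k ^ 2, by linear_combination hV⟩
    have hW' : W ^ 2 = Q ^ k - (Q - P ^ 2) * lucasU (2 * P) Q k ^ 2 := by
      rw [hW] at hV
      linarith
    have hWodd : Odd W := by
      have : Odd (W ^ 2) := by
        rw [hW']
        exact hQ.pow.sub_even ((hQ.sub_odd hP.pow).mul_right _)
      exact (Int.odd_pow' two_ne_zero).1 this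
    rw [lucasU_two_mul, hW] at h
    have hc : IsCoprime ((2 : ℤ) ^ f) W := by
      apply IsCoprime.pow_left
      exact (Int.isCoprime_iff_gcd_eq_one.2 (by
        rw [Int.gcd_comm]
        exact Int.isCoprime_iff_gcd_eq_one.1 (Int.isCoprime_two_right.2 hWodd)))
    have h' : (2 : ℤ) ^ f ∣ (g * 2) * lucasU (2 * P) Q k := by
      apply hc.dvd_of_dvd_mul_right
      rwa [show g * 2 * lucasU (2 * P) Q k * W = g * (lucasU (2 * P) Q k * (2 * W)) by ring]
    rw [show g * ((2 * k : ℕ) : ℤ) = g * 2 * k by push_cast; ring]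
    exact ih k (by omega) (g * 2) h'
  · have hU : ¬ (2 : ℤ) ∣ lucasU (2 * P) Q n := by
      intro hU
      refine h2 (hp.dvd_of_dvd_lucasU (u := P) ?_ ?_ ?_ hU)
      · rwa [← even_iff_two_dvd, Int.not_even_iff_odd]
      · simp
      · exact (hQ.sub_odd hP.pow).two_dvd
    exact ((IsCoprime.pow_left ((hp.coprime_iff_not_dvd).2 hU)).dvd_of_dvd_mul_right h).mul_right _

theorem three_pow_dvd_of_dvd_mul_lucasU {P Q : ℤ} (hD : 9 ∣ 4 * Q - P ^ 2) (hQ : ¬ 3 ∣ Q) {f : ℕ}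
    (g : ℤ) (n : ℕ) (h : 3 ^ f ∣ g * lucasU P Q n) : 3 ^ f ∣ g * n := by
  have hp : Prime (3 : ℤ) := Int.prime_three
  induction n using Nat.strong_induction_on generalizing g with
  | _ n ih =>
  obtain ⟨D, hD'⟩ := hD
  by_cases h3 : (3 : ℤ) ∣ n
  · obtain ⟨k, rfl⟩ : 3 ∣ n := by exact_mod_cast h3
    rcases Nat.eq_zero_or_pos k with rfl | hk
    · simp
    have hc : IsCoprime ((3 : ℤ) ^ f) (Q ^ k - 3 * (D * lucasU P Q k ^ 2)) := by
      apply IsCoprime.pow_left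
      rw [hp.coprime_iff_not_dvd]
      intro h'
      exact hQ (hp.dvd_of_dvd_pow ((dvd_sub_left (dvd_mul_right 3 _)).1 h'))
    rw [lucasU_three_mul, hD', show g * (lucasU P Q k * (3 * Q ^ k - 9 * D * lucasU P Q k ^ 2)) =
      g * 3 * lucasU P Q k * (Q ^ k - 3 * (D * lucasU P Q k ^ 2)) by ring] at h
    rw [show g * ((3 * k : ℕ) : ℤ) = g * 3 * k by push_cast; ring]
    exact ih k (by omega) (g * 3) (hc.dvd_of_dvd_mul_right h)
  · have hU : ¬ (3 : ℤ) ∣ lucasU P Q n := by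
      intro hU
      have hQP : (3 : ℤ) ∣ Q - P ^ 2 := ⟨3 * D - Q, by linear_combination hD'⟩
      refine h3 (hp.dvd_of_dvd_lucasU (u := -P) ?_ ?_ ?_ hU)
      · intro hP
        exact hQ ((dvd_iff_dvd_of_dvd_sub hQP).2 (((dvd_neg.1 hP)).pow two_ne_zero))
      · exact ⟨P, by ring⟩
      · simpa using hQP
    exact ((IsCoprime.pow_left ((hp.coprime_iff_not_dvd).2 hU)).dvd_of_dvd_mul_right h).mul_right _

theorem two_pow_dvd_of_dvd_nine_pow_sub_one {k h : ℕ} (H : (2 : ℤ) ^ (k + 3) ∣ 9 ^ h - 1) :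
    2 ^ k ∣ h := by
  have h' := two_pow_dvd_of_dvd_mul_lucasU (P := 5) (Q := 9) (by decide) (by decide) (f := k) 1 h
  rw [show (2 * 5 : ℤ) = 9 + 1 by norm_num] at h'
  rw [← sub_one_mul_lucasU 9 h, pow_add, mul_comm] at H
  norm_num at H h'
  exact_mod_cast h' ((mul_dvd_mul_iff_left (by norm_num)).1 H)

theorem three_pow_dvd_of_dvd_four_pow_sub_one {k h : ℕ} (H : (3 : ℤ) ^ (k + 1) ∣ 4 ^ h - 1) :
    3 ^ k ∣ h := by
  have h' := three_pow_dvd_of_dvd_mul_lucasU (P := 4 + 1) (Q := 4) (by norm_num) (by decide)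
    (f := k) 1 h
  rw [← sub_one_mul_lucasU 4 h, pow_succ, mul_comm] at H
  norm_num at H h'
  exact_mod_cast h' ((mul_dvd_mul_iff_left (by norm_num)).1 H)

/-- Two elements of prime power norm in an imaginary quadratic order whose discriminant is not too
small, neither of them divisible by the prime, agree up to conjugation and sign. -/
theorem sq_eq_sq_of_sq_add_mul_sq_eq {p D V W z w : ℤ} {k : ℕ} (hp : Prime p) (hD : 4 < D)
    (hz : V ^ 2 + D * z ^ 2 = 4 * p ^ k) (hw : W ^ 2 + D * w ^ 2 = 4 * p ^ k)
    (h2 : 2 ∣ V * w + z * W) (hV : ¬ p ∣ V) (hpw : ¬ p ∣ w) : z ^ 2 = w ^ 2 := by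
  obtain ⟨f, hf⟩ := h2
  obtain ⟨g, hg⟩ : (2 : ℤ) ∣ V * w - z * W := by
    exact ⟨f - z * W, by linear_combination hf⟩
  have hfg : f * g = p ^ k * (w ^ 2 - z ^ 2) := by
    have : (V * w + z * W) * (V * w - z * W) = 4 * (p ^ k * (w ^ 2 - z ^ 2)) := by
      linear_combination w ^ 2 * hz - z ^ 2 * hw
    rw [hf, hg] at this
    linarith
  have hsum : f + g = V * w := by linarith
  have hpk : p ^ k ≠ 0 := pow_ne_zero _ hp.ne_zero
  have key : ∀ t R : ℤ, R ^ 2 + D * (2 * t) ^ 2 = (4 * p ^ k) * (4 * p ^ k) → p ^ k ∣ t →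
      t = 0 := by
    rintro _ R hR ⟨t, rfl⟩
    by_contra ht
    have ht' : t ≠ 0 := by
      rintro rfl
      simp at ht
    have h1 : 1 ≤ t ^ 2 := by
      have : 0 < t ^ 2 := by positivity
      linarith
    have h3 : 0 < (p ^ k) ^ 2 := by positivity
    have h4 : D * (p ^ k) ^ 2 * t ^ 2 ≤ 4 * (p ^ k) ^ 2 := by nlinarith [sq_nonneg R]
    nlinarith [mul_le_mul_of_nonneg_left h1 (by positivity : 0 ≤ D * (p ^ k) ^ 2)]
  have hnorm₁ : (V * W - D * z * w) ^ 2 + D * (2 * f) ^ 2 = (4 * p ^ k) * (4 * p ^ k) := by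
    rw [← hf, ← hz]
    nth_rw 2 [hz]
    rw [← hw]
    ring
  have hnorm₂ : (V * W + D * z * w) ^ 2 + D * (2 * g) ^ 2 = (4 * p ^ k) * (4 * p ^ k) := by
    rw [← hg, ← hz]
    nth_rw 2 [hz]
    rw [← hw]
    ring
  have h0 : f * g = 0 := by
    by_cases hpf : p ∣ f
    · have hpg : ¬ p ∣ g := by
        intro hpg
        have := dvd_add hpf hpg
        rw [hsum] at this
        exact (hp.dvd_or_dvd this).elim hV hpw
      rw [key f _ hnorm₁ (hp.pow_dvd_of_dvd_mul_right k hpg ⟨_, hfg⟩), zero_mul]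
    · rw [key g _ hnorm₂ (hp.pow_dvd_of_dvd_mul_left k hpf ⟨_, hfg⟩), mul_zero]
  rw [hfg] at h0
  have := (mul_eq_zero.1 h0).resolve_left hpk
  linarith

theorem not_three_dvd_two_pow (n : ℕ) : ¬ (3 : ℤ) ∣ 2 ^ n := fun h => by
  have := Int.prime_three.dvd_of_dvd_pow h
  norm_num at this

/-- Two representations `2 ^ m = 3 ^ n + c` of the same `c > 0`, with exponents of equal parity for
`3`, are far apart. -/
theorem three_pow_dvd_of_two_pow_eq {s d y h : ℕ} {c : ℤ} (hs : 1 ≤ s) (hy : 1 ≤ y) (hc : 0 < c)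
    (h₁ : (2 : ℤ) ^ (s + 2) = 3 ^ y + c) (h₂ : (2 : ℤ) ^ (s + d + 2) = 3 ^ (y + 2 * h) + c) :
    (3 : ℤ) ^ h ∣ 3 * (2 ^ s - 1) * (s + d : ℕ) := by
  set P₁ : ℤ := 3 ^ y - 2 ^ (s + 1) with hP₁
  set P₂ : ℤ := 3 ^ (y + 2 * h) - 2 ^ (s + d + 1) with hP₂
  have hp2 : Prime (2 : ℤ) := Int.prime_two
  have hp3 : Prime (3 : ℤ) := Int.prime_three
  have odd3 : ∀ n : ℕ, Odd ((3 : ℤ) ^ n) := fun n => Odd.pow (by decide)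
  have even2 : ∀ n : ℕ, Even ((2 : ℤ) ^ (n + 1)) := fun n => ⟨2 ^ n, by ring⟩
  have hodd : ∀ {m : ℤ}, ¬ 2 ∣ m → Odd m := fun {m} hm => by
    rwa [← even_iff_two_dvd, Int.not_even_iff_odd] at hm
  have hodd' : ∀ {m : ℤ}, Odd m → ¬ 2 ∣ m := fun {m} hm => by
    rwa [← even_iff_two_dvd, Int.not_even_iff_odd]
  have hP₁odd : ¬ 2 ∣ P₁ := hodd' ((odd3 y).sub_even (even2 s))
  have hP₂odd : ¬ 2 ∣ P₂ := hodd' ((odd3 _).sub_even (even2 _))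
  have hD₁ : 4 * (4 : ℤ) ^ s - P₁ ^ 2 = 3 ^ y * c := by
    have : c = 4 * 2 ^ s - 3 ^ y := by linear_combination -h₁
    rw [hP₁, this, show (4 : ℤ) = 2 ^ 2 by norm_num, ← pow_mul]
    ring
  have hD₂ : 4 * (4 : ℤ) ^ (s + d) - P₂ ^ 2 = 3 ^ y * c * (3 ^ h) ^ 2 := by
    have : c = 4 * 2 ^ (s + d) - 3 ^ (y + 2 * h) := by linear_combination -h₂
    rw [hP₂, show (3 : ℤ) ^ y * c * (3 ^ h) ^ 2 = 3 ^ (y + 2 * h) * c by ring, this,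
      show (4 : ℤ) = 2 ^ 2 by norm_num, ← pow_mul]
    ring
  have h2Q : ∀ n : ℕ, 1 ≤ n → (2 : ℤ) ∣ 4 ^ n := fun n hn =>
    (show (2 : ℤ) ∣ 4 by norm_num).pow (by omega)
  have hV₁ := hp2.not_dvd_lucasV (h2Q s hs) hP₁odd (n := s + d) (by omega)
  have hU₁ := hp2.not_dvd_lucasU (h2Q s hs) hP₁odd (n := s + d) (by omega)
  have hV₂ := hp2.not_dvd_lucasV (h2Q (s + d) (by omega)) hP₂odd (n := s) (by omega)
  have hU₂ := hp2.not_dvd_lucasU (h2Q (s + d) (by omega)) hP₂odd (n := s) (by omega)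
  have hw : Odd (3 ^ h * lucasU P₂ (4 ^ (s + d)) s) := (odd3 h).mul (hodd hU₂)
  have hz₁ := lucasV_sq_add P₁ (4 ^ s) (s + d)
  have hz₂ := lucasV_sq_add P₂ (4 ^ (s + d)) s
  rw [hD₁] at hz₁
  rw [hD₂] at hz₂
  have hD : 4 < 3 ^ y * c := by
    have h3 : (3 : ℤ) ≤ 3 ^ y := by
      simpa using pow_le_pow_right₀ (by norm_num : (1 : ℤ) ≤ 3) hy
    have h8 : (2 : ℤ) ^ 3 ≤ 2 ^ (s + 2) :=
      pow_le_pow_right₀ (by norm_num : (1 : ℤ) ≤ 2) (by omega)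
    nlinarith [mul_nonneg (by linarith : (0 : ℤ) ≤ 3 ^ y - 1) (by linarith : 0 ≤ c - 1)]
  have key := sq_eq_sq_of_sq_add_mul_sq_eq (p := 2) (k := 2 * s * (s + d)) hp2 hD
    (V := lucasV P₁ (4 ^ s) (s + d)) (z := lucasU P₁ (4 ^ s) (s + d))
    (W := lucasV P₂ (4 ^ (s + d)) s) (w := 3 ^ h * lucasU P₂ (4 ^ (s + d)) s)
    (by
      rw [hz₁, show (4 : ℤ) = 2 ^ 2 by norm_num, ← pow_mul, ← pow_mul]
      ring)
    (by
      rw [mul_pow, ← mul_assoc, hz₂, show (4 : ℤ) = 2 ^ 2 by norm_num, ← pow_mul, ← pow_mul]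
      ring)
    (((hodd hV₁).mul hw).add_odd ((hodd hU₁).mul (hodd hV₂))).two_dvd
    hV₁ (hodd' hw)
  have hU : (3 : ℤ) ^ h ∣ lucasU P₁ (4 ^ s) (s + d) := by
    rw [← Int.pow_dvd_pow_iff two_ne_zero, key]
    exact pow_dvd_pow_of_dvd (dvd_mul_right _ _) 2
  obtain ⟨y, rfl⟩ := Nat.exists_eq_add_of_le' hy
  have hU₃ : lucasU P₁ (4 ^ s) 3 = 3 * (4 ^ s - 3 ^ y * c) := by
    have := lucasU_three_mul P₁ (4 ^ s) 1
    rw [lucasU_one, hD₁] at this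
    simp only [mul_one, pow_one, one_mul] at this
    rw [this]
    ring
  have hdvd : (3 : ℤ) ^ h ∣ lucasU P₁ (4 ^ s) 3 *
      lucasU (lucasV P₁ (4 ^ s) 3) ((4 ^ s) ^ 3) (s + d) := by
    rw [← lucasU_mul, mul_comm 3, lucasU_mul]
    exact hU.mul_right _
  have h3Q : ¬ (3 : ℤ) ∣ (4 ^ s) ^ 3 := by
    rw [← pow_mul, show (4 : ℤ) = 2 ^ 2 by norm_num, ← pow_mul]
    exact not_three_dvd_two_pow _
  have h9 : (9 : ℤ) ∣ 4 * (4 ^ s) ^ 3 - lucasV P₁ (4 ^ s) 3 ^ 2 := by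
    have := lucasV_sq_add P₁ (4 ^ s) 3
    rw [hD₁, hU₃] at this
    exact ⟨3 ^ (y + 1) * c * (4 ^ s - 3 ^ y * c) ^ 2, by linear_combination -this⟩
  have hdvd' := three_pow_dvd_of_dvd_mul_lucasU h9 h3Q _ _ hdvd
  rw [hU₃] at hdvd'
  have h3s : ¬ (3 : ℤ) ∣ 4 ^ s := by
    rw [show (4 : ℤ) = 2 ^ 2 by norm_num, ← pow_mul]
    exact not_three_dvd_two_pow _
  rcases Nat.eq_zero_or_pos y with rfl | hy'
  · have hfac : (4 : ℤ) ^ s - 3 ^ 0 * c = (2 ^ s - 1) * (2 ^ s - 3) := by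
      rw [show c = 4 * 2 ^ s - 3 by linear_combination -h₁, show (4 : ℤ) ^ s = (2 ^ s) ^ 2 by
        rw [← pow_mul, mul_comm s 2, pow_mul]; norm_num]
      ring
    rw [hfac] at hdvd'
    have hcop : IsCoprime ((3 : ℤ) ^ h) (2 ^ s - 3) := by
      apply IsCoprime.pow_left
      rw [hp3.coprime_iff_not_dvd]
      intro h'
      exact not_three_dvd_two_pow s ((dvd_sub_left (dvd_refl 3)).1 h')
    apply hcop.dvd_of_dvd_mul_right
    rwa [show 3 * (2 ^ s - 1) * ((s + d : ℕ) : ℤ) * (2 ^ s - 3) =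
      3 * ((2 ^ s - 1) * (2 ^ s - 3)) * ((s + d : ℕ) : ℤ) by ring]
  · have hcop : IsCoprime ((3 : ℤ) ^ h) (4 ^ s - 3 ^ y * c) := by
      apply IsCoprime.pow_left
      rw [hp3.coprime_iff_not_dvd]
      intro h'
      exact h3s ((dvd_sub_left ((dvd_pow_self 3 (by omega : y ≠ 0)).mul_right c)).1 h')
    have : (3 : ℤ) ^ h ∣ 3 * (s + d : ℕ) := by
      apply hcop.dvd_of_dvd_mul_right
      rwa [mul_right_comm]
    rw [mul_right_comm]
    exact this.mul_right _

/-- Two representations `3 ^ n = 2 ^ m + c` of the same `c > 0`, with exponents of equal parity for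
`2`, are far apart. -/
theorem two_pow_dvd_of_three_pow_eq {a b y h : ℕ} {c : ℤ} (hy : 1 ≤ y) (hb : 1 ≤ b)
    (hc : 0 < c) (h₁ : (3 : ℤ) ^ y = 2 ^ a + c) (h₂ : (3 : ℤ) ^ b = 2 ^ (a + 2 * h) + c) :
    2 ^ h ∣ b := by
  set P₁ : ℤ := 2 ^ (a + 1) - 3 ^ y with hP₁
  set P₂ : ℤ := 2 ^ (a + 2 * h + 1) - 3 ^ b with hP₂
  have hp3 : Prime (3 : ℤ) := Int.prime_three
  have odd3 : ∀ n : ℕ, Odd ((3 : ℤ) ^ n) := fun n => Odd.pow (by decide)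
  have even2 : ∀ n : ℕ, Even ((2 : ℤ) ^ (n + 1)) := fun n => ⟨2 ^ n, by ring⟩
  have hP : ∀ m n : ℕ, 1 ≤ n → ¬ (3 : ℤ) ∣ 2 * (2 ^ (m + 1) - 3 ^ n) := by
    intro m n hn h'
    rcases hp3.dvd_or_dvd h' with h' | h'
    · norm_num at h'
    · exact not_three_dvd_two_pow _ ((dvd_sub_left (dvd_pow_self 3 (by omega))).1 h')
  have h3Q : ∀ n : ℕ, 1 ≤ n → (3 : ℤ) ∣ 9 ^ n := fun n hn =>
    (show (3 : ℤ) ∣ 9 by norm_num).pow (by omega)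
  have hD₁ : 4 * (9 : ℤ) ^ y - (2 * P₁) ^ 2 = 16 * 2 ^ a * c := by
    have : c = 3 ^ y - 2 ^ a := by linear_combination -h₁
    rw [hP₁, this, show (9 : ℤ) = 3 ^ 2 by norm_num, ← pow_mul]
    ring
  have hD₂ : 4 * (9 : ℤ) ^ b - (2 * P₂) ^ 2 = 16 * 2 ^ a * c * (2 ^ h) ^ 2 := by
    have : c = 3 ^ b - 2 ^ (a + 2 * h) := by linear_combination -h₂
    rw [hP₂, show 16 * 2 ^ a * c * (2 ^ h) ^ 2 = 16 * 2 ^ (a + 2 * h) * c by ring, this,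
      show (9 : ℤ) = 3 ^ 2 by norm_num, ← pow_mul]
    ring
  have hV₁ := hp3.not_dvd_lucasV (h3Q y hy) (hP a y hy) (n := b) (by omega)
  have hU₂ := hp3.not_dvd_lucasU (h3Q b hb) (hP (a + 2 * h) b hb) (n := y) (by omega)
  have hVeven : ∀ (P Q : ℤ) (n : ℕ), 2 ∣ lucasV (2 * P) Q n := fun P Q n => by
    rw [lucasV_eq]
    exact ⟨lucasU (2 * P) Q (n + 1) - P * lucasU (2 * P) Q n, by ring⟩
  have hz₁ := lucasV_sq_add (2 * P₁) (9 ^ y) b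
  have hz₂ := lucasV_sq_add (2 * P₂) (9 ^ b) y
  rw [hD₁] at hz₁
  rw [hD₂] at hz₂
  have hD : 4 < 16 * 2 ^ a * c := by
    have : (1 : ℤ) ≤ 2 ^ a := one_le_pow₀ (by norm_num)
    nlinarith
  have key := sq_eq_sq_of_sq_add_mul_sq_eq (p := 3) (k := 2 * y * b) hp3 hD
    (V := lucasV (2 * P₁) (9 ^ y) b) (z := lucasU (2 * P₁) (9 ^ y) b)
    (W := lucasV (2 * P₂) (9 ^ b) y) (w := 2 ^ h * lucasU (2 * P₂) (9 ^ b) y)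
    (by
      rw [hz₁, show (9 : ℤ) = 3 ^ 2 by norm_num, ← pow_mul, ← pow_mul]
      ring)
    (by
      rw [mul_pow, ← mul_assoc, hz₂, show (9 : ℤ) = 3 ^ 2 by norm_num, ← pow_mul, ← pow_mul]
      ring)
    (dvd_add ((hVeven _ _ _).mul_right _) ((hVeven _ _ _).mul_left _))
    hV₁ (fun h' => (hp3.dvd_or_dvd h').elim (not_three_dvd_two_pow h) hU₂)
  have hU : (2 : ℤ) ^ h ∣ 1 * lucasU (2 * P₁) (9 ^ y) b := by
    rw [one_mul, ← Int.pow_dvd_pow_iff two_ne_zero, key]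
    exact pow_dvd_pow_of_dvd (dvd_mul_right _ _) 2
  have := two_pow_dvd_of_dvd_mul_lucasU ((even2 a).sub_odd (odd3 y))
    (Odd.pow (by decide : Odd (9 : ℤ))) 1 b hU
  rw [one_mul] at this
  exact_mod_cast this

theorem eq_of_three_pow_lt_two_pow {s d y h : ℕ} (hs : 1 ≤ s) (hy : 1 ≤ y) (hh : 1 ≤ h)
    (hlt : 3 ^ y < 2 ^ (s + 2))
    (H : 2 ^ (s + d + 2) + 3 ^ y = 2 ^ (s + 2) + 3 ^ (y + 2 * h)) :
    (s, d, y, h) = (1, 2, 1, 1) ∨ (s, d, y, h) = (2, 4, 1, 2) := by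
  have hltZ : (3 : ℤ) ^ y < 2 ^ (s + 2) := by exact_mod_cast hlt
  have HZ : (2 : ℤ) ^ (s + d + 2) + 3 ^ y = 2 ^ (s + 2) + 3 ^ (y + 2 * h) := by exact_mod_cast H
  have hfac : (2 : ℤ) ^ (s + 2) * (2 ^ d - 1) = 3 ^ y * (9 ^ h - 1) := by
    rw [show (9 : ℤ) = 3 ^ 2 by norm_num, ← pow_mul]
    linear_combination HZ
  have hs2 : 2 ^ (s - 1) ≤ h := by
    apply Nat.le_of_dvd hh
    apply two_pow_dvd_of_dvd_nine_pow_sub_one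
    rw [show s - 1 + 3 = s + 2 by omega]
    have hcop : IsCoprime ((2 : ℤ) ^ (s + 2)) (3 ^ y) :=
      IsCoprime.pow (Int.isCoprime_iff_gcd_eq_one.2 rfl)
    exact hcop.dvd_of_dvd_mul_left ⟨_, hfac.symm⟩
  have hd : d < 4 * h := by
    have h9 : (1 : ℤ) ≤ 9 ^ h := one_le_pow₀ (by norm_num)
    have h3 : (0 : ℤ) < 3 ^ y := by positivity
    have h1 : (2 : ℤ) ^ d ≤ 9 ^ h := by
      by_contra hcon
      nlinarith
    have h2 : (9 : ℤ) ^ h < 16 ^ h := pow_lt_pow_left₀ (by norm_num) (by norm_num) (by omega)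
    have h4 : (2 : ℤ) ^ d < 2 ^ (4 * h) := by
      rw [pow_mul]
      norm_num
      linarith
    exact (pow_lt_pow_iff_right₀ (by norm_num)).1 h4
  have hs1 : s ≤ h := by
    have := (s - 1).lt_two_pow_self
    omega
  have hle : 3 ^ h ≤ 30 * h ^ 2 := by
    have hdvd := three_pow_dvd_of_two_pow_eq (c := 2 ^ (s + 2) - 3 ^ y) hs hy (by linarith)
      (by ring) (by linarith : (2 : ℤ) ^ (s + d + 2) = 3 ^ (y + 2 * h) + (2 ^ (s + 2) - 3 ^ y))
    have h2s : (2 : ℤ) ^ s ≤ 2 * h := by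
      obtain ⟨s, rfl⟩ := Nat.exists_eq_add_of_le' hs
      rw [pow_succ]
      have : (2 : ℤ) ^ s ≤ h := by exact_mod_cast hs2
      linarith
    have h2s' : (2 : ℤ) ≤ 2 ^ s := by
      simpa using pow_le_pow_right₀ (by norm_num : (1 : ℤ) ≤ 2) hs
    have hsd : ((s + d : ℕ) : ℤ) ≤ 5 * h := by
      have : s + d ≤ 5 * h := by omega
      exact_mod_cast this
    have hsd' : (0 : ℤ) < (s + d : ℕ) := by
      have : 0 < s + d := by omega
      exact_mod_cast this
    have hle := Int.le_of_dvd (mul_pos (by linarith) hsd') hdvd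
    have : (3 : ℤ) ^ h ≤ 30 * h ^ 2 := by nlinarith
    exact_mod_cast this
  have hh6 : h < 7 := by
    by_contra! hcon
    have : ∀ n : ℕ, 7 ≤ n → 30 * n ^ 2 < 3 ^ n := by
      intro n hn
      induction n, hn using Nat.le_induction with
      | base => norm_num
      | succ n hn ih =>
        rw [pow_succ 3]
        nlinarith
    exact absurd hle (this h hcon).not_ge
  have hs3 : s < 4 := by
    by_contra! hcon
    have : 2 ^ 3 ≤ 2 ^ (s - 1) := Nat.pow_le_pow_right (by norm_num) (by omega)
    omega
  have hy3 : y < 4 := by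
    by_contra! hcon
    have h1 : 3 ^ 4 ≤ 3 ^ y := Nat.pow_le_pow_right (by norm_num) hcon
    have h2 : 2 ^ (s + 2) ≤ 2 ^ 5 := Nat.pow_le_pow_right (by norm_num) (by omega)
    omega
  have hd24 : d < 24 := by omega
  have key : ∀ s ∈ Finset.Ico 1 4, ∀ y ∈ Finset.Ico 1 4, ∀ h ∈ Finset.Ico 1 7,
      ∀ d ∈ Finset.range 24,
      2 ^ (s + d + 2) + 3 ^ y = 2 ^ (s + 2) + 3 ^ (y + 2 * h) →
      (s, d, y, h) = (1, 2, 1, 1) ∨ (s, d, y, h) = (2, 4, 1, 2) := by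
    decide +kernel
  exact key s (Finset.mem_Ico.2 ⟨hs, hs3⟩) y (Finset.mem_Ico.2 ⟨hy, hy3⟩)
    h (Finset.mem_Ico.2 ⟨hh, hh6⟩) d (Finset.mem_range.2 hd24) H

theorem eq_of_two_pow_lt_three_pow {a y e h : ℕ} (ha : 1 ≤ a) (hy : 1 ≤ y) (hh : 1 ≤ h)
    (hlt : 2 ^ a < 3 ^ y)
    (H : 2 ^ (a + 2 * h) + 3 ^ y = 2 ^ a + 3 ^ (y + e)) :
    (a, y, e, h) = (1, 1, 1, 1) := by
  have hltZ : (2 : ℤ) ^ a < 3 ^ y := by exact_mod_cast hlt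
  have HZ : (2 : ℤ) ^ (a + 2 * h) + 3 ^ y = 2 ^ a + 3 ^ (y + e) := by exact_mod_cast H
  have hfac : (3 : ℤ) ^ y * (3 ^ e - 1) = 2 ^ a * (4 ^ h - 1) := by
    rw [show (4 : ℤ) = 2 ^ 2 by norm_num, ← pow_mul]
    linear_combination -HZ
  have hy1 : y ≤ h := by
    have h3 : 3 ^ (y - 1) ≤ h := by
      apply Nat.le_of_dvd hh
      apply three_pow_dvd_of_dvd_four_pow_sub_one
      rw [Nat.sub_add_cancel hy]
      have hcop : IsCoprime ((3 : ℤ) ^ y) (2 ^ a) :=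
        IsCoprime.pow (Int.isCoprime_iff_gcd_eq_one.2 rfl)
      exact hcop.dvd_of_dvd_mul_left ⟨_, hfac.symm⟩
    have := (y - 1).lt_pow_self (by norm_num : 1 < 3)
    omega
  have he : e < 2 * h := by
    have h4 : (4 : ℤ) ≤ 4 ^ h := by
      simpa using pow_le_pow_right₀ (by norm_num : (1 : ℤ) ≤ 4) hh
    have h2 : (0 : ℤ) < 2 ^ a := by positivity
    have h1 : (3 : ℤ) ^ e < 4 ^ h := by
      by_contra hcon
      nlinarith
    have h3 : (2 : ℤ) ^ e ≤ 3 ^ e := pow_le_pow_left₀ (by norm_num) (by norm_num) e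
    have h5 : (2 : ℤ) ^ e < 2 ^ (2 * h) := by
      rw [pow_mul]
      norm_num
      linarith
    exact (pow_lt_pow_iff_right₀ (by norm_num)).1 h5
  have hle : 2 ^ h ≤ y + e := by
    apply Nat.le_of_dvd (by omega)
    exact two_pow_dvd_of_three_pow_eq (a := a) (c := 3 ^ y - 2 ^ a) hy (by omega) (by linarith)
      (by ring) (by linarith)
  have hh3 : h < 4 := by
    by_contra! hcon
    have : ∀ n : ℕ, 4 ≤ n → 3 * n < 2 ^ n := by
      intro n hn
      induction n, hn using Nat.le_induction with
      | base => norm_num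
      | succ n hn ih =>
        rw [pow_succ]
        omega
    have := this h hcon
    omega
  have ha5 : a < 5 := by
    by_contra! hcon
    have h1 : 2 ^ 5 ≤ 2 ^ a := Nat.pow_le_pow_right (by norm_num) hcon
    have h2 : 3 ^ y ≤ 3 ^ 3 := Nat.pow_le_pow_right (by norm_num) (by omega)
    omega
  have key : ∀ a ∈ Finset.Ico 1 5, ∀ y ∈ Finset.Ico 1 4, ∀ h ∈ Finset.Ico 1 4,
      ∀ e ∈ Finset.range 6, 2 ^ a < 3 ^ y →
      2 ^ (a + 2 * h) + 3 ^ y = 2 ^ a + 3 ^ (y + e) → (a, y, e, h) = (1, 1, 1, 1) := by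
    decide +kernel
  exact key a (Finset.mem_Ico.2 ⟨ha, ha5⟩) y (Finset.mem_Ico.2 ⟨hy, by omega⟩)
    h (Finset.mem_Ico.2 ⟨hh, hh3⟩) e (Finset.mem_range.2 (by omega)) hlt H

theorem even_of_three_dvd_two_pow_sub_one {d : ℕ} (h : (3 : ℤ) ∣ 2 ^ d - 1) : Even d := by
  by_contra hd
  obtain ⟨k, rfl⟩ := Nat.not_even_iff_odd.1 hd
  have h4 : (3 : ℤ) ∣ 4 ^ k - 1 := by simpa using sub_dvd_pow_sub_pow (4 : ℤ) 1 k
  rw [pow_succ, pow_mul] at h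
  norm_num at h
  omega

theorem even_of_four_dvd_three_pow_sub_one {e : ℕ} (h : (4 : ℤ) ∣ 3 ^ e - 1) : Even e := by
  by_contra he
  obtain ⟨k, rfl⟩ := Nat.not_even_iff_odd.1 he
  have h8 : (8 : ℤ) ∣ 9 ^ k - 1 := by simpa using sub_dvd_pow_sub_pow (9 : ℤ) 1 k
  rw [pow_succ, pow_mul] at h
  norm_num at h
  omega

theorem case_y_pos (x y a b : ℕ) (hx : 0 < x) (hy : 0 < y) (ha : 0 < a) (hb : 0 < b)
    (hxa : x > a) :
    2 ^ x + 3 ^ y = 2 ^ a + 3 ^ b ↔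
      (x, y, a, b) = (3, 1, 1, 2) ∨ (x, y, a, b) = (5, 1, 3, 3) ∨ (x, y, a, b) = (8, 1, 4, 5) := by
  constructor
  swap
  · simp only [Prod.mk.injEq]
    rintro (⟨rfl, rfl, rfl, rfl⟩ | ⟨rfl, rfl, rfl, rfl⟩ | ⟨rfl, rfl, rfl, rfl⟩) <;> norm_num
  intro H
  obtain ⟨d, rfl⟩ := Nat.exists_eq_add_of_lt hxa
  have hyb : y < b := by
    have : 2 ^ a < 2 ^ (a + d + 1) := Nat.pow_lt_pow_right (by norm_num) (by omega)
    exact (Nat.pow_lt_pow_iff_right (by norm_num : 1 < 3)).1 (by omega)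
  obtain ⟨e, rfl⟩ := Nat.exists_eq_add_of_lt hyb
  rw [add_assoc] at H ⊢
  rw [add_assoc y] at H ⊢
  generalize hd' : d + 1 = D at *
  generalize he' : e + 1 = E at *
  have HZ : (2 : ℤ) ^ a * (2 ^ D - 1) = 3 ^ y * (3 ^ E - 1) := by
    have : (2 : ℤ) ^ (a + D) + 3 ^ y = 2 ^ a + 3 ^ (y + E) := by exact_mod_cast H
    linear_combination this
  have hDeven : Even D := by
    apply even_of_three_dvd_two_pow_sub_one
    have hcop : IsCoprime (3 : ℤ) (2 ^ a) :=
      IsCoprime.pow_right (Int.isCoprime_iff_gcd_eq_one.2 rfl)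
    exact hcop.dvd_of_dvd_mul_left (HZ ▸ (dvd_pow_self 3 hy.ne').mul_right _)
  rcases Nat.lt_or_ge (3 ^ y) (2 ^ a) with hlt | hge
  · have h3 : 3 ≤ 3 ^ y := Nat.le_self_pow hy.ne' 3
    have ha2 : 2 ≤ a := by
      by_contra! hcon
      obtain rfl : a = 1 := by omega
      omega
    have hEeven : Even E := by
      apply even_of_four_dvd_three_pow_sub_one
      have hcop : IsCoprime (4 : ℤ) (3 ^ y) :=
        IsCoprime.pow_right (Int.isCoprime_iff_gcd_eq_one.2 rfl)
      have h4 : (4 : ℤ) ∣ 2 ^ a := by simpa using pow_dvd_pow (2 : ℤ) ha2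
      exact hcop.dvd_of_dvd_mul_left (HZ ▸ h4.mul_right _)
    obtain ⟨h, rfl⟩ := hEeven.exists_two_nsmul
    rw [smul_eq_mul] at *
    have ha3 : a ≠ 2 := by
      rintro rfl
      obtain ⟨k, hk⟩ : (8 : ℤ) ∣ 9 ^ h - 1 := by simpa using sub_dvd_pow_sub_pow (9 : ℤ) 1 h
      rw [← hd', pow_succ, pow_mul 3, show (3 : ℤ) ^ 2 = 9 by norm_num, hk,
        show (3 : ℤ) ^ y * (8 * k) = 8 * (3 ^ y * k) by ring] at HZ
      omega
    obtain ⟨s, rfl⟩ := Nat.exists_eq_add_of_le' ha2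
    have key := eq_of_three_pow_lt_two_pow (s := s) (d := D) (by omega) hy (by omega : 1 ≤ h) hlt
      (by rwa [add_right_comm])
    simp only [Prod.mk.injEq] at key ⊢
    omega
  · have hne : 2 ^ a ≠ 3 ^ y := fun heq => by
      have h2 : Even (2 ^ a) := (by decide : Even 2).pow_of_ne_zero ha.ne'
      rw [heq] at h2
      exact Nat.not_even_iff_odd.2 (Odd.pow (by decide)) h2
    obtain ⟨h, rfl⟩ := hDeven.exists_two_nsmul
    rw [smul_eq_mul] at *
    have key := eq_of_two_pow_lt_three_pow ha hy (by omega : 1 ≤ h) (lt_of_le_of_ne hge hne) H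
    simp only [Prod.mk.injEq] at key ⊢
    omega
end
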